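/- Let H be an N×N hermitian Wigner matrix satisfying condition C1. For any κ > 0, K > 0 and 2 ≤ p < ∞ there exist constants C = C(κ,K,p) and c = c(κ,K,p) > 0 such that for any interval I ⊂ [−2+κ, 2−κ] of length |I| = K/N, one has P( there exists a unit vector v with Hv = μv for some μ ∈ I and ‖v‖_p ≥ M N^{1/p − 1/2} ) ≤ C e^{−c√M} for all M ≥ 0 and all N ≥ 2, where ‖v‖_p is the ℓ^p-norm of the coordinate vector of v. -/

import Mathlib

open MeasureTheory ProbabilityTheory
open scoped ENNReal NNReal

noncomputable section

/-- The density of the Wigner semicircle law. -/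
def rhoSC (x : ℝ) : ℝ := if |x| ≤ 2 then Real.sqrt (4 - x ^ 2) / (2 * Real.pi) else 0

/-- The Stieltjes transform of the Wigner semicircle law. -/
def mSC (z : ℂ) : ℂ := ∫ x : ℝ, (rhoSC x : ℂ) / ((x : ℂ) - z)

/-- The Stieltjes transform of the empirical eigenvalue distribution of a matrix:
`m(z) = N⁻¹ Tr (H - z)⁻¹`. -/
def stTrans {N : ℕ} (A : Matrix (Fin N) (Fin N) ℂ) (z : ℂ) : ℂ :=
  (Matrix.trace (A - z • (1 : Matrix (Fin N) (Fin N) ℂ))⁻¹) / (N : ℂ)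

open scoped Classical in
/-- The number of eigenvalues (with multiplicity) of a Hermitian matrix lying in a set `I`. -/
def eigCount {N : ℕ} {A : Matrix (Fin N) (Fin N) ℂ} (hA : A.IsHermitian) (I : Set ℝ) : ℕ :=
  (Finset.univ.filter fun i => hA.eigenvalues i ∈ I).card

/-- `ν` has a strictly positive density `h` on `ℝ² ≃ ℂ` which is either a product of two copies
of a one-variable function or radially symmetric. -/
def WignerDensityOf (ν : Measure ℂ) (h : ℝ → ℝ → ℝ) : Prop :=
  (∀ x y, 0 < h x y) ∧
  ν = (volume : Measure ℂ).withDensity (fun z => ENNReal.ofReal (h z.re z.im)) ∧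
  ((∃ hs : ℝ → ℝ, ∀ x y, h x y = hs x * hs y) ∨
   (∃ hs : ℝ → ℝ, ∀ x y, h x y = hs (x ^ 2 + y ^ 2)))

/-- Condition C1, with explicit constants: Gaussian moments of the off-diagonal law `ν`
and of the diagonal law `ν'` are bounded by `D` resp. `D'`. -/
def CondC1 (ν : Measure ℂ) (ν' : Measure ℝ) (δ₀ D D' : ℝ) : Prop :=
  0 < δ₀ ∧
  (∫⁻ z, ENNReal.ofReal (Real.exp (δ₀ * ‖z‖ ^ 2)) ∂ν) ≤ ENNReal.ofReal D ∧
  (∫⁻ x, ENNReal.ofReal (Real.exp (δ₀ * x ^ 2)) ∂ν') ≤ ENNReal.ofReal D'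

/-- `H` is an `N × N` hermitian Wigner ensemble on the probability space `(Ω, P)`:
the entries above the diagonal are i.i.d. with law `N^{-1/2} ν` where `ν` has mean zero,
variance one and a density as in `WignerDensityOf`; the diagonal entries are real i.i.d.
with law `N^{-1/2} ν'`, `ν'` of mean zero; and all these entries are independent. -/
structure IsWignerMatrix {Ω : Type} [MeasurableSpace Ω] (P : Measure Ω) (N : ℕ)
    (H : Ω → Matrix (Fin N) (Fin N) ℂ) (ν : Measure ℂ) (ν' : Measure ℝ) : Prop where
  herm : ∀ ω, (H ω).IsHermitian
  prob : IsProbabilityMeasure P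
  probν : IsProbabilityMeasure ν
  probν' : IsProbabilityMeasure ν'
  density : ∃ h, WignerDensityOf ν h
  mean : (∫ z, z ∂ν) = 0
  var : (∫ z, ‖z‖ ^ 2 ∂ν) = 1
  mean' : (∫ x, x ∂ν') = 0
  offdiag : ∀ i j : Fin N, i < j →
    P.map (fun ω => (Real.sqrt N : ℂ) * H ω i j) = ν
  diag : ∀ i : Fin N, P.map (fun ω => Real.sqrt N * (H ω i i).re) = ν'
  diag_real : ∀ ω i, (H ω i i).im = 0
  indep : iIndepFun
    (fun (p : {p : Fin N × Fin N // p.1 ≤ p.2}) (ω : Ω) => H ω p.1.1 p.1.2) P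
/-- The Fourier transform on `ℝ²` of a real function of two variables. -/
def fourier2 (f : ℝ → ℝ → ℝ) (t s : ℝ) : ℂ :=
  ∫ x : ℝ, ∫ y : ℝ, Complex.exp (-Complex.I * (t * x + s * y)) * (f x y : ℂ)

/-- The Laplacian of a function of two real variables. -/
def laplacian2 (g : ℝ → ℝ → ℝ) (x y : ℝ) : ℝ :=
  deriv (deriv (fun t => g t y)) x + deriv (deriv (fun t => g x t)) y

/-- Condition C2 with exponent `a` and constants `w`, `w'`: decay of the Fourier transforms
of the density `h` and of `h · Δ(-log h)`. -/
def CondC2 (h : ℝ → ℝ → ℝ) (a : ℕ) (w w' : ℝ) : Prop :=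
  0 < w ∧ 0 < w' ∧
  (∀ t s : ℝ, ‖fourier2 h t s‖ ≤ 1 / (1 + w * (t ^ 2 + s ^ 2)) ^ a) ∧
  (∀ t s : ℝ, ‖fourier2
      (fun x y => h x y * laplacian2 (fun u v => -Real.log (h u v)) x y) t s‖
    ≤ 1 / (1 + w' * (t ^ 2 + s ^ 2)) ^ a)

/-- Either the real and imaginary parts under `ν` are i.i.d., or `ν` is rotationally
symmetric. -/
def ComplexSymm (ν : Measure ℂ) : Prop :=
  (∃ μ₀ : Measure ℝ,
    ν = Measure.map (fun p : ℝ × ℝ => (p.1 : ℂ) + p.2 * Complex.I) (μ₀.prod μ₀)) ∨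
  (∀ θ : ℝ, Measure.map (fun z => Complex.exp (θ * Complex.I) * z) ν = ν)
section Mat
open Matrix

set_option linter.unusedSectionVars false
set_option linter.unusedDecidableInType false
set_option linter.unusedFintypeInType false

section LA
variable {n : Type*} [Fintype n] [DecidableEq n]

/-- squared euclidean norm -/
def nsq (v : n → ℂ) : ℝ := ∑ i, ‖v i‖ ^ 2

/-- resolvent -/
def res (H : Matrix n n ℂ) (E η : ℝ) : Matrix n n ℂ :=
  (H - ((E : ℂ) + η * Complex.I) • (1 : Matrix n n ℂ))⁻¹

theorem nsq_nonneg (v : n → ℂ) : 0 ≤ nsq v := Finset.sum_nonneg fun i _ => by positivity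

theorem nsq_eq (v : n → ℂ) : ((nsq v : ℝ) : ℂ) = star v ⬝ᵥ v := by
  simp only [nsq, dotProduct, Pi.star_apply, RCLike.star_def]
  push_cast
  refine Finset.sum_congr rfl fun i _ => ?_
  rw [← Complex.normSq_eq_conj_mul_self, Complex.normSq_eq_norm_sq]
  push_cast; rfl

theorem quad_real {H : Matrix n n ℂ} (hH : H.IsHermitian) (x : n → ℂ) :
    (star x ⬝ᵥ H *ᵥ x).im = 0 := by
  have h : star (star x ⬝ᵥ H *ᵥ x) = star x ⬝ᵥ H *ᵥ x := by
    rw [← star_dotProduct_star, star_star, star_mulVec, hH.eq, ← dotProduct_mulVec, dotProduct_comm, dotProduct_comm]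
  exact Complex.conj_eq_iff_im.mp h

theorem sub_mulVec' (H : Matrix n n ℂ) (z : ℂ) (x : n → ℂ) :
    (H - z • (1 : Matrix n n ℂ)) *ᵥ x = H *ᵥ x - z • x := by
  simp [sub_mulVec, smul_mulVec]

theorem nsq_shift {H : Matrix n n ℂ} (hH : H.IsHermitian) (E η : ℝ) (x : n → ℂ) :
    nsq ((H - ((E : ℂ) + η * Complex.I) • (1 : Matrix n n ℂ)) *ᵥ x)
      = nsq ((H - ((E : ℂ)) • (1 : Matrix n n ℂ)) *ᵥ x) + η ^ 2 * nsq x := by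
  set y := (H - ((E : ℂ)) • (1 : Matrix n n ℂ)) *ᵥ x with hy
  have h1 : (H - ((E : ℂ) + η * Complex.I) • (1 : Matrix n n ℂ)) *ᵥ x = y - (η * Complex.I) • x := by
    rw [hy, sub_mulVec', sub_mulVec', add_smul, sub_sub]
  have hy2 : star y ⬝ᵥ x = star x ⬝ᵥ y := by
    rw [hy, star_mulVec, ← dotProduct_mulVec]
    congr 2
    simp [conjTranspose_sub, hH.eq]
  have key : ((nsq (y - (η * Complex.I) • x) : ℝ) : ℂ) = ((nsq y + η ^ 2 * nsq x : ℝ) : ℂ) := by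
    push_cast
    rw [nsq_eq, nsq_eq, nsq_eq]
    simp only [star_sub, star_smul, sub_dotProduct, dotProduct_sub, smul_dotProduct, dotProduct_smul, hy2,
      smul_eq_mul, star_mul', RCLike.star_def, Complex.conj_I, Complex.conj_ofReal]
    linear_combination (-(η:ℂ) ^ 2 * (star x ⬝ᵥ x)) * Complex.I_sq
  rw [h1]
  exact_mod_cast key

theorem nsq_eq_zero {v : n → ℂ} (h : nsq v = 0) : v = 0 := by
  ext i
  have := (Finset.sum_eq_zero_iff_of_nonneg (fun i _ => by positivity)).1 h i (Finset.mem_univ i)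
  simpa using this

theorem res_unit {H : Matrix n n ℂ} (hH : H.IsHermitian) (E : ℝ) {η : ℝ} (hη : 0 < η) :
    IsUnit (H - ((E : ℂ) + η * Complex.I) • (1 : Matrix n n ℂ)).det := by
  rw [isUnit_iff_ne_zero]
  intro h
  obtain ⟨v, hv, hv0⟩ := Matrix.exists_mulVec_eq_zero_iff.2 h
  have h1 := nsq_shift hH E η v
  rw [hv0] at h1
  have h2 : nsq (0 : n → ℂ) = 0 := by simp [nsq]
  have h3 := nsq_nonneg ((H - ((E : ℂ)) • (1 : Matrix n n ℂ)) *ᵥ v)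
  have h4 := nsq_nonneg v
  have h5 : η ^ 2 * nsq v = 0 := by
    have : 0 ≤ η ^ 2 * nsq v := by positivity
    linarith
  have h6 : nsq v = 0 := by
    rcases mul_eq_zero.1 h5 with h | h
    · exact absurd h (by positivity)
    · exact h
  exact hv (nsq_eq_zero h6)

theorem mul_res {H : Matrix n n ℂ} (hH : H.IsHermitian) (E : ℝ) {η : ℝ} (hη : 0 < η) :
    (H - ((E : ℂ) + η * Complex.I) • (1 : Matrix n n ℂ)) * res H E η = 1 :=
  Matrix.mul_nonsing_inv _ (res_unit hH E hη)

theorem res_mul {H : Matrix n n ℂ} (hH : H.IsHermitian) (E : ℝ) {η : ℝ} (hη : 0 < η) :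
    res H E η * (H - ((E : ℂ) + η * Complex.I) • (1 : Matrix n n ℂ)) = 1 :=
  Matrix.nonsing_inv_mul _ (res_unit hH E hη)

theorem res_eq_of {H : Matrix n n ℂ} (hH : H.IsHermitian) (E : ℝ) {η : ℝ} (hη : 0 < η) {x y : n → ℂ}
    (h : (H - ((E : ℂ) + η * Complex.I) • (1 : Matrix n n ℂ)) *ᵥ x = y) : res H E η *ᵥ y = x := by
  rw [← h, mulVec_mulVec, res_mul hH E hη, one_mulVec]

/-- Ward identity -/
theorem ward {H : Matrix n n ℂ} (hH : H.IsHermitian) (E : ℝ) {η : ℝ} (hη : 0 < η) (x : n → ℂ) :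
    (star x ⬝ᵥ res H E η *ᵥ x).im = η * nsq (res H E η *ᵥ x) := by
  set y := res H E η *ᵥ x with hy
  have hx : x = (H - ((E : ℂ) + η * Complex.I) • (1 : Matrix n n ℂ)) *ᵥ y := by
    rw [hy, mulVec_mulVec, mul_res hH E hη, one_mulVec]
  have h1 : star x ⬝ᵥ y = star y ⬝ᵥ H *ᵥ y - ((E : ℂ) - η * Complex.I) * (nsq y : ℝ) := by
    rw [hx, sub_mulVec', star_sub, sub_dotProduct, star_smul, smul_dotProduct, nsq_eq, star_mulVec, hH.eq,
      ← dotProduct_mulVec]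
    simp
    left; ring
  rw [h1, Complex.sub_im, quad_real hH]
  simp

theorem res_mono {H : Matrix n n ℂ} (hH : H.IsHermitian) (E : ℝ) {η η' : ℝ} (hη : 0 < η) (h : η ≤ η')
    (x : n → ℂ) : nsq (res H E η' *ᵥ x) ≤ nsq (res H E η *ᵥ x) := by
  have hη' := hη.trans_le h
  set A := (H - ((E : ℂ) + η * Complex.I) • (1 : Matrix n n ℂ)) with hA
  set A' := (H - ((E : ℂ) + η' * Complex.I) • (1 : Matrix n n ℂ)) with hA'
  have hc : A * A' = A' * A := by
    rw [hA, hA']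
    simp [sub_mul, mul_sub, smul_sub, smul_smul, mul_comm]
    abel
  set u := res H E η *ᵥ (res H E η' *ᵥ x) with hu
  have h1 : A *ᵥ u = res H E η' *ᵥ x := by
    rw [hu, mulVec_mulVec, mul_res hH E hη, one_mulVec]
  have h2 : A' *ᵥ u = res H E η *ᵥ x := by
    symm
    apply res_eq_of hH E hη
    rw [← hA, mulVec_mulVec, hc, ← mulVec_mulVec, h1, mulVec_mulVec, mul_res hH E hη', one_mulVec]
  rw [← h1, ← h2, hA, hA', nsq_shift hH, nsq_shift hH]
  have := nsq_nonneg u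
  have : η ^ 2 ≤ η' ^ 2 := by gcongr
  gcongr

theorem res_star {H : Matrix n n ℂ} (hH : H.IsHermitian) (E : ℝ) {η : ℝ} (hη : 0 < η) (x : n → ℂ) :
    nsq ((res H E η)ᴴ *ᵥ x) = nsq (res H E η *ᵥ x) := by
  set A := (H - ((E : ℂ) + η * Complex.I) • (1 : Matrix n n ℂ)) with hA
  set R := res H E η with hR
  have hc : A * Aᴴ = Aᴴ * A := by
    rw [hA]
    simp [sub_mul, mul_sub, smul_sub, smul_smul, mul_comm, conjTranspose_sub, hH.eq]
    abel
  have h1 : A * R = 1 := mul_res hH E hη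
  have h2 : R * A = 1 := res_mul hH E hη
  have h3 : Rᴴ * Aᴴ = 1 := by rw [← conjTranspose_mul, h1, conjTranspose_one]
  have h4 : Aᴴ * Rᴴ = 1 := by rw [← conjTranspose_mul, h2, conjTranspose_one]
  have hRR : R * Rᴴ = Rᴴ * R := by
    calc R * Rᴴ = Rᴴ * Aᴴ * (R * Rᴴ) := by rw [h3, one_mul]
      _ = Rᴴ * (R * A) * Aᴴ * (R * Rᴴ) := by rw [h2, mul_one]
      _ = Rᴴ * R * (A * Aᴴ) * (R * Rᴴ) := by simp only [mul_assoc]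
      _ = Rᴴ * R * (Aᴴ * A) * (R * Rᴴ) := by rw [hc]
      _ = Rᴴ * R * (Aᴴ * (A * R) * Rᴴ) := by simp only [mul_assoc]
      _ = Rᴴ * R := by rw [h1, mul_one, h4, mul_one]
  have key : ((nsq (Rᴴ *ᵥ x) : ℝ) : ℂ) = ((nsq (R *ᵥ x) : ℝ) : ℂ) := by
    rw [nsq_eq, nsq_eq, star_mulVec, star_mulVec, ← dotProduct_mulVec, ← dotProduct_mulVec, mulVec_mulVec,
      mulVec_mulVec, conjTranspose_conjTranspose, hRR]
  exact_mod_cast key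

theorem dot_le (x y : n → ℂ) : ‖star x ⬝ᵥ y‖ ≤ (nsq x + nsq y) / 2 := by
  unfold dotProduct nsq
  refine (norm_sum_le _ _).trans ?_
  rw [← Finset.sum_add_distrib, Finset.sum_div]
  refine Finset.sum_le_sum fun i _ => ?_
  simp only [Pi.star_apply, norm_mul, norm_star]
  nlinarith [sq_nonneg (‖x i‖ - ‖y i‖)]

/-- the matrix with row and column `k` set to zero -/
def minor (k : n) (H : Matrix n n ℂ) : Matrix n n ℂ :=
  Matrix.of fun i j => if i = k ∨ j = k then 0 else H i j

/-- the `k`-th column without the diagonal entry -/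
def colv (k : n) (H : Matrix n n ℂ) : n → ℂ := fun j => if j = k then 0 else H j k

theorem minor_herm {H : Matrix n n ℂ} (hH : H.IsHermitian) (k : n) : (minor k H).IsHermitian := by
  ext i j
  simp only [conjTranspose_apply, minor, of_apply]
  have := hH.apply i j
  by_cases h1 : i = k <;> by_cases h2 : j = k <;> simp [h1, h2]
  simpa using this

theorem mulVec_decomp {H : Matrix n n ℂ} (hH : H.IsHermitian) (k : n) (x : n → ℂ) :
    H *ᵥ x = minor k H *ᵥ x + x k • colv k H
      + (star (colv k H) ⬝ᵥ x + H k k * x k) • (Pi.single k 1 : n → ℂ) := by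
  have hs : ∀ f : n → ℂ, ∑ j, f j = f k + ∑ j ∈ Finset.univ.erase k, f j := fun f =>
    (Finset.add_sum_erase _ _ (Finset.mem_univ k)).symm
  ext i
  simp only [mulVec, dotProduct, Pi.add_apply, Pi.smul_apply, smul_eq_mul, Pi.star_apply]
  by_cases hi : i = k
  · subst hi
    simp only [minor, colv, of_apply, true_or, if_true, zero_mul, Finset.sum_const_zero, mul_zero, zero_add,
      Pi.single_eq_same, mul_one]
    rw [hs, hs (fun j => star (if j = i then 0 else H j i) * x j)]
    simp only [if_true, star_zero, zero_mul, zero_add]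
    rw [add_comm]
    congr 1
    refine Finset.sum_congr rfl fun j hj => ?_
    rw [if_neg (Finset.ne_of_mem_erase hj), hH.apply]
  · simp only [minor, colv, of_apply, hi, false_or, if_false]
    rw [hs, hs (fun j => (if j = k then 0 else H i j) * x j)]
    simp only [if_true, zero_mul, zero_add, Pi.single_eq_of_ne hi, mul_zero, add_zero]
    rw [add_comm, mul_comm (x k)]
    congr 1
    refine Finset.sum_congr rfl fun j hj => ?_
    rw [if_neg (Finset.ne_of_mem_erase hj)]

theorem minor_mulVec_k (k : n) (H : Matrix n n ℂ) (x : n → ℂ) : (minor k H *ᵥ x) k = 0 := by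
  simp [minor, mulVec, dotProduct]

/-- if `x k = 0` then `(R x) k = 0` for the resolvent of the minor -/
theorem res_minor_k {H : Matrix n n ℂ} (hH : H.IsHermitian) (k : n) (E : ℝ) {η : ℝ} (hη : 0 < η)
    {x : n → ℂ} (hx : x k = 0) : (res (minor k H) E η *ᵥ x) k = 0 := by
  set y := res (minor k H) E η *ᵥ x with hy
  have h1 : (minor k H - ((E : ℂ) + η * Complex.I) • (1 : Matrix n n ℂ)) *ᵥ y = x := by
    rw [hy, mulVec_mulVec, mul_res (minor_herm hH k) E hη, one_mulVec]
  rw [sub_mulVec'] at h1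
  have h2 := congrFun h1 k
  simp only [Pi.sub_apply, minor_mulVec_k, Pi.smul_apply, smul_eq_mul, hx, zero_sub, neg_eq_zero,
    mul_eq_zero] at h2
  rcases h2 with h | h
  · exfalso
    have := congrArg Complex.im h
    simp at this
    exact hη.ne' this
  · exact h

/-- the denominator in the Schur formula -/
def den (k : n) (H : Matrix n n ℂ) (E η : ℝ) : ℂ :=
  H k k - ((E : ℂ) + η * Complex.I) - star (colv k H) ⬝ᵥ res (minor k H) E η *ᵥ colv k H

/-- the imaginary part of minus the denominator -/
def Yk (k : n) (H : Matrix n n ℂ) (E η : ℝ) : ℝ :=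
  η * (1 + nsq (res (minor k H) E η *ᵥ colv k H))

theorem den_im {H : Matrix n n ℂ} (hH : H.IsHermitian) (k : n) (E : ℝ) {η : ℝ} (hη : 0 < η) :
    (den k H E η).im = - Yk k H E η := by
  have h1 : (H k k).im = 0 := Complex.conj_eq_iff_im.mp (hH.apply k k)
  simp only [den, Yk, Complex.sub_im, ward (minor_herm hH k) E hη, h1]
  simp
  ring

theorem Yk_pos (k : n) (H : Matrix n n ℂ) (E : ℝ) {η : ℝ} (hη : 0 < η) : η ≤ Yk k H E η := by
  have := nsq_nonneg (res (minor k H) E η *ᵥ colv k H)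
  unfold Yk
  nlinarith

theorem Yk_le_den {H : Matrix n n ℂ} (hH : H.IsHermitian) (k : n) (E : ℝ) {η : ℝ} (hη : 0 < η) :
    Yk k H E η ≤ ‖den k H E η‖ := by
  have h := Complex.abs_im_le_norm (den k H E η)
  rw [den_im hH k E hη, abs_neg] at h
  exact (le_abs_self _).trans h

theorem Yk_half {H : Matrix n n ℂ} (hH : H.IsHermitian) (k : n) (E : ℝ) {η : ℝ} (hη : 0 < η) :
    Yk k H E η ≤ 2 * Yk k H E (η / 2) := by
  have := res_mono (minor_herm hH k) E (half_pos hη) (by linarith : η / 2 ≤ η) (colv k H)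
  unfold Yk
  nlinarith

theorem den_ne {H : Matrix n n ℂ} (hH : H.IsHermitian) (k : n) (E : ℝ) {η : ℝ} (hη : 0 < η) :
    den k H E η ≠ 0 := by
  intro h
  have h1 := Yk_le_den hH k E hη
  have h2 := Yk_pos k H E hη
  rw [h, norm_zero] at h1
  linarith

theorem schur_vec {H : Matrix n n ℂ} (hH : H.IsHermitian) (k : n) (E : ℝ) {η : ℝ} (hη : 0 < η) :
    (H - ((E : ℂ) + η * Complex.I) • (1 : Matrix n n ℂ)) *ᵥ
      ((Pi.single k 1 : n → ℂ) - res (minor k H) E η *ᵥ colv k H) = den k H E η • (Pi.single k 1 : n → ℂ) := by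
  set b := colv k H with hb
  set y := res (minor k H) E η *ᵥ b with hy
  have hbk : b k = 0 := by simp [hb, colv]
  have hyk : y k = 0 := res_minor_k hH k E hη hbk
  have h1 : minor k H *ᵥ y - ((E : ℂ) + η * Complex.I) • y = b := by
    rw [← sub_mulVec', hy, mulVec_mulVec, mul_res (minor_herm hH k) E hη, one_mulVec]
  have h2 : minor k H *ᵥ (Pi.single k 1 : n → ℂ) = 0 := by
    ext i; simp [minor]
  rw [sub_mulVec', mulVec_decomp hH k, mulVec_sub, h2, ← hb]
  have h3 : minor k H *ᵥ y = b + ((E : ℂ) + η * Complex.I) • y := by rw [← h1]; abel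
  rw [h3]
  simp only [Pi.sub_apply, hyk, Pi.single_eq_same, dotProduct_sub, den, dotProduct_single, Pi.star_apply, hbk,
    ← hb, ← hy]
  ext i
  simp
  ring

theorem schur_kk {H : Matrix n n ℂ} (hH : H.IsHermitian) (k : n) (E : ℝ) {η : ℝ} (hη : 0 < η) :
    res H E η k k = (den k H E η)⁻¹ := by
  have h1 := res_eq_of hH E hη (schur_vec hH k E hη)
  have h2 := congrFun h1 k
  have hyk : (res (minor k H) E η *ᵥ colv k H) k = 0 := res_minor_k hH k E hη (by simp [colv])
  rw [mulVec_smul] at h2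
  simp [hyk] at h2
  exact eq_inv_of_mul_eq_one_right h2

theorem schur_jj {H : Matrix n n ℂ} (hH : H.IsHermitian) (k : n) (E : ℝ) {η : ℝ} (hη : 0 < η) (j : n)
    (hj : j ≠ k) :
    res H E η j j = res (minor k H) E η j j + (den k H E η)⁻¹ *
      ((star (colv k H) ᵥ* res (minor k H) E η) j * (res (minor k H) E η *ᵥ colv k H) j) := by
  set b := colv k H with hb
  set R := res (minor k H) E η with hR
  set ej := (Pi.single j 1 : n → ℂ) with hej
  have hjk : (R *ᵥ ej) k = 0 := res_minor_k hH k E hη (by simp [hej, Pi.single_eq_of_ne (Ne.symm hj)])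
  have h1 : minor k H *ᵥ (R *ᵥ ej) = ej + ((E : ℂ) + η * Complex.I) • (R *ᵥ ej) := by
    have : minor k H *ᵥ (R *ᵥ ej) - ((E : ℂ) + η * Complex.I) • (R *ᵥ ej) = ej := by
      rw [← sub_mulVec', mulVec_mulVec, mul_res (minor_herm hH k) E hη, one_mulVec]
    exact sub_eq_iff_eq_add.1 this
  have h2 : (H - ((E : ℂ) + η * Complex.I) • (1 : Matrix n n ℂ)) *ᵥ (R *ᵥ ej)
      = ej + (star b ⬝ᵥ R *ᵥ ej) • (Pi.single k 1 : n → ℂ) := by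
    rw [sub_mulVec', mulVec_decomp hH k, h1, hjk, ← hb]
    ext i; simp; ring
  have h3 : (H - ((E : ℂ) + η * Complex.I) • (1 : Matrix n n ℂ)) *ᵥ
      (R *ᵥ ej - ((star b ⬝ᵥ R *ᵥ ej) * (den k H E η)⁻¹) • ((Pi.single k 1 : n → ℂ) - R *ᵥ b)) = ej := by
    rw [mulVec_sub, mulVec_smul, schur_vec hH k E hη, h2, smul_smul, mul_assoc, inv_mul_cancel₀ (den_ne hH k E hη),
      mul_one]
    abel
  have h4 := congrFun (res_eq_of hH E hη h3) j
  have h5 : (star b ᵥ* R) j = star b ⬝ᵥ R *ᵥ ej := by rw [dotProduct_mulVec, hej, dotProduct_single, mul_one]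
  rw [h5]
  simp [hej, Pi.single_eq_of_ne hj] at h4 ⊢
  rw [h4]; ring

/-- partial trace of the minor resolvent -/
def ptr (k : n) (H : Matrix n n ℂ) (E η : ℝ) : ℂ :=
  ∑ j ∈ Finset.univ.erase k, res (minor k H) E η j j

theorem trace_diff {H : Matrix n n ℂ} (hH : H.IsHermitian) (k : n) (E : ℝ) {η : ℝ} (hη : 0 < η) :
    ‖(res H E η).trace - ptr k H E η‖ ≤ 1 / η := by
  set b := colv k H with hb
  set R := res (minor k H) E η with hR
  have hRb : (R *ᵥ b) k = 0 := res_minor_k hH k E hη (by simp [hb, colv])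
  have h1 : (res H E η).trace - ptr k H E η
      = (den k H E η)⁻¹ * (1 + (star b ᵥ* R) ⬝ᵥ (R *ᵥ b)) := by
    unfold Matrix.trace ptr dotProduct
    rw [← Finset.add_sum_erase _ _ (Finset.mem_univ k),
      ← Finset.add_sum_erase _ (fun i => (star b ᵥ* R) i * (R *ᵥ b) i) (Finset.mem_univ k), hRb, mul_zero, zero_add,
      mul_add, Finset.mul_sum, add_sub_assoc, ← Finset.sum_sub_distrib]
    simp only [diag_apply]
    rw [schur_kk hH k E hη, mul_one]
    congr 1
    refine Finset.sum_congr rfl fun j hj => ?_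
    rw [schur_jj hH k E hη j (Finset.ne_of_mem_erase hj)]
    ring
  have h2 : ‖(star b ᵥ* R) ⬝ᵥ (R *ᵥ b)‖ ≤ nsq (R *ᵥ b) := by
    have h3 : star b ᵥ* R = star (Rᴴ *ᵥ b) := by rw [star_mulVec, conjTranspose_conjTranspose]
    rw [h3]
    refine (dot_le _ _).trans ?_
    rw [res_star (minor_herm hH k) E hη]
    linarith
  rw [h1, norm_mul, norm_inv]
  have h4 := Yk_le_den hH k E hη
  have h5 := nsq_nonneg (R *ᵥ b)
  have h6 : ‖1 + (star b ᵥ* R) ⬝ᵥ (R *ᵥ b)‖ ≤ 1 + nsq (R *ᵥ b) :=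
    (norm_add_le _ _).trans (by rw [norm_one]; linarith)
  have h7 : 0 < Yk k H E η := hη.trans_le (Yk_pos k H E hη)
  calc ‖den k H E η‖⁻¹ * ‖1 + (star b ᵥ* R) ⬝ᵥ (R *ᵥ b)‖ ≤ (Yk k H E η)⁻¹ * (1 + nsq (R *ᵥ b)) := by
        gcongr
    _ = 1 / η := by
        unfold Yk
        rw [← hb, ← hR]
        field_simp

theorem trace_im {H : Matrix n n ℂ} (hH : H.IsHermitian) (E : ℝ) {η : ℝ} (hη : 0 < η) :
    (res H E η).trace.im = η * ∑ j, nsq (res H E η *ᵥ (Pi.single j 1 : n → ℂ)) := by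
  unfold Matrix.trace
  rw [Complex.im_sum, Finset.mul_sum]
  refine Finset.sum_congr rfl fun j _ => ?_
  rw [← ward hH E hη]
  congr 1
  have : star (Pi.single j 1 : n → ℂ) = Pi.single j 1 := by
    ext i; by_cases h : i = j <;> simp [Pi.single_apply, h]
  rw [this]; simp

theorem trace_half {H : Matrix n n ℂ} (hH : H.IsHermitian) (E : ℝ) {η : ℝ} (hη : 0 < η) :
    (res H E η).trace.im ≤ 2 * (res H E (η / 2)).trace.im := by
  rw [trace_im hH E hη, trace_im hH E (half_pos hη)]
  have : ∑ j, nsq (res H E η *ᵥ (Pi.single j 1 : n → ℂ)) ≤ ∑ j, nsq (res H E (η / 2) *ᵥ (Pi.single j 1 : n → ℂ)) :=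
    Finset.sum_le_sum fun j _ => res_mono hH E (half_pos hη) (by linarith) _
  nlinarith

/-- Frobenius norm of the minor resolvent off index `k` -/
theorem ptr_im {H : Matrix n n ℂ} (hH : H.IsHermitian) (k : n) (E : ℝ) {η : ℝ} (hη : 0 < η) :
    (ptr k H E η).im = η * ∑ i, ∑ j, ‖if i = k ∨ j = k then (0 : ℂ) else res (minor k H) E η i j‖ ^ 2 := by
  unfold ptr
  rw [Complex.im_sum, Finset.sum_comm, ← Finset.add_sum_erase _ _ (Finset.mem_univ k)]
  simp only [or_true, if_true, norm_zero]
  have h0 : ∑ _x : n, (0 : ℝ) ^ 2 = 0 := by simp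
  rw [h0, zero_add, Finset.mul_sum]
  refine Finset.sum_congr rfl fun j hj => ?_
  have hj := Finset.ne_of_mem_erase hj
  have h1 := ward (minor_herm hH k) E hη (Pi.single j 1 : n → ℂ)
  have h2 : star (Pi.single j 1 : n → ℂ) = Pi.single j 1 := by
    ext i; by_cases h : i = j <;> simp [Pi.single_apply, h]
  have h3 := res_minor_k hH k E hη (x := (Pi.single j 1 : n → ℂ)) (by simp [Pi.single_eq_of_ne (Ne.symm hj)])
  rw [h2] at h1
  simp only [mulVec_single_one, single_dotProduct, col_apply, one_mul] at h1 h3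
  rw [h1]
  congr 1
  unfold nsq
  refine Finset.sum_congr rfl fun i _ => ?_
  by_cases hi : i = k
  · subst hi; simp [h3]
  · simp [hi, hj]

/-- eigenvectors against the resolvent -/
theorem eig_bound {H : Matrix n n ℂ} (hH : H.IsHermitian) (k : n) (E μ : ℝ) {η : ℝ} (hη : 0 < η)
    (hμ : |μ - E| ≤ η) (v : n → ℂ) (hv : nsq v = 1) (hv' : H *ᵥ v = (μ : ℂ) • v) :
    ‖v k‖ ^ 2 ≤ 2 * η / Yk k H E η := by
  set e := (Pi.single k 1 : n → ℂ) with he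
  set g := res H E η *ᵥ e with hg
  have h2 : star e = e := by
    ext i; by_cases h : i = k <;> simp [he, Pi.single_apply, h]
  have h1 := ward hH E hη e
  rw [h2] at h1
  have h3 : (res H E η k k).im = η * nsq g := by
    rw [← h1, he]; simp
  have h4 : (H - ((E : ℂ) + η * Complex.I) • (1 : Matrix n n ℂ)) *ᵥ g = e := by
    rw [hg, mulVec_mulVec, mul_res hH E hη, one_mulVec]
  have h5 : ((μ : ℂ) - ((E : ℂ) + η * Complex.I)) * (star v ⬝ᵥ g) = star (v k) := by
    have : star v ⬝ᵥ e = star (v k) := by rw [he]; simp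
    rw [← this, ← h4, sub_mulVec', dotProduct_sub, dotProduct_mulVec _ H]
    have : star v ᵥ* H = (μ : ℂ) • star v := by
      rw [← star_star (star v ᵥ* H)]
      have h : star (star v ᵥ* H) = H *ᵥ v := by
        rw [star_vecMul, star_star, hH.eq]
      rw [h, hv', star_smul]; simp
    rw [this, smul_dotProduct, dotProduct_smul]
    simp [sub_mul]
  have h6 : ‖star v ⬝ᵥ g‖ ^ 2 ≤ nsq g := by
    have hcs : ∀ t : ℝ, 0 < t → ‖star v ⬝ᵥ g‖ * (2 * t) ≤ t ^ 2 * nsq v + nsq g := by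
      intro t ht
      have := dot_le ((t : ℂ) • v) g
      have e1 : nsq ((t : ℂ) • v) = t ^ 2 * nsq v := by
        simp [nsq, Finset.mul_sum, mul_pow]
      rw [e1, star_smul, smul_dotProduct] at this
      simp only [RCLike.star_def, Complex.conj_ofReal, smul_eq_mul, norm_mul, Complex.norm_real, Real.norm_eq_abs,
        abs_of_pos ht] at this
      linarith
    rcases (norm_nonneg (star v ⬝ᵥ g)).eq_or_lt with h | h
    · rw [← h]; simpa using nsq_nonneg g
    · have := hcs _ h
      rw [hv] at this
      nlinarith
  have h7 : ‖(μ : ℂ) - ((E : ℂ) + η * Complex.I)‖ ^ 2 ≤ 2 * η ^ 2 := by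
    rw [← Complex.normSq_eq_norm_sq, Complex.normSq_apply]
    simp
    have := abs_le.1 hμ
    nlinarith
  have h8 : ‖v k‖ ^ 2 ≤ 2 * η ^ 2 * nsq g := by
    rw [← norm_star (v k), ← h5, norm_mul, mul_pow]
    have := nsq_nonneg g
    gcongr
  have h9 : (res H E η k k).im ≤ (Yk k H E η)⁻¹ := by
    refine (Complex.abs_im_le_norm _ |> (le_abs_self _).trans).trans ?_
    rw [schur_kk hH k E hη, norm_inv]
    exact inv_anti₀ (hη.trans_le (Yk_pos k H E hη)) (Yk_le_den hH k E hη)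
  rw [h3] at h9
  rw [div_eq_mul_inv]
  nlinarith

end LA

section Det

theorem selfcons {m ε : ℂ} {E η κ c : ℝ} (hm : 0 ≤ m.im) (hη : 0 < η) (hη2 : η ≤ 2 * c) (hc : 0 < c)
    (hcκ : 4 * c ^ 2 ≤ κ / 2) (hE : E ^ 2 / 4 ≤ 1 - κ) (hε : ‖ε‖ ≤ κ / 2)
    (h : m * m + ((E : ℂ) + η * Complex.I) * m + 1 = ε) : c ≤ m.im := by
  have h1 := congrArg Complex.re h
  simp at h1
  have h2 : ε.re ≤ κ / 2 := (Complex.re_le_norm ε).trans hε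
  have h3 : (m.im + η / 2) ^ 2 ≥ (2 * c) ^ 2 := by
    nlinarith [sq_nonneg (m.re + E / 2), sq_nonneg η]
  have h4 : 2 * c ≤ m.im + η / 2 := by
    apply le_of_sq_le_sq _ (by positivity)
    linarith
  linarith

variable {n : Type*} [Fintype n] [DecidableEq n]

/-- regularized imaginary part of the normalized trace of the minor resolvent -/
def Tp (k : n) (H : Matrix n n ℂ) (E η : ℝ) : ℝ := (ptr k H E η).im / Fintype.card n + η

/-- fluctuation in the Schur formula -/
def Om (k : n) (H : Matrix n n ℂ) (E η : ℝ) : ℂ :=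
  H k k - (star (colv k H) ⬝ᵥ res (minor k H) E η *ᵥ colv k H - ptr k H E η / Fintype.card n)

/-- the bad event -/
def bad (θ δ : ℝ) (k : n) (H : Matrix n n ℂ) (E η : ℝ) : Prop :=
  θ ≤ Tp k H E η ∧ δ * Tp k H E η < ‖Om k H E η‖

theorem good_Y {H : Matrix n n ℂ} (hH : H.IsHermitian) (k : n) (E : ℝ) {η : ℝ} (hη : 0 < η) {δ : ℝ}
    (hT : 0 ≤ Tp k H E η) (hδ : δ ≤ 1 / 2) (hO : ‖Om k H E η‖ ≤ δ * Tp k H E η) :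
    Tp k H E η / 2 ≤ Yk k H E η := by
  have h1 : den k H E η = Om k H E η - ((E : ℂ) + η * Complex.I) - ptr k H E η / Fintype.card n := by
    unfold den Om; ring
  have h2 := den_im hH k E hη
  rw [h1] at h2
  have h3 : (ptr k H E η / (Fintype.card n : ℂ)).im = (ptr k H E η).im / Fintype.card n := by
    rw [← Complex.ofReal_natCast, Complex.div_ofReal_im]
  simp only [Complex.sub_im, Complex.add_im, Complex.ofReal_im, Complex.mul_im, Complex.I_im, Complex.I_re,
    Complex.ofReal_re, h3] at h2
  have h4 := (le_abs_self _).trans (Complex.abs_im_le_norm (Om k H E η))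
  unfold Tp at *
  nlinarith

theorem main_step [Nonempty n] {H : Matrix n n ℂ} (hH : H.IsHermitian) {E η κ c x0 δ' : ℝ}
    (hη : 0 < η) (hη2 : η ≤ 2 * c) (hc : 0 < c) (hc1 : c ≤ 1 / 2) (hκ : 0 < κ) (hκ1 : κ ≤ 1)
    (hcκ : 4 * c ^ 2 ≤ κ / 2) (hE : E ^ 2 / 4 ≤ 1 - κ)
    (hx0 : x0 = 64 / (c * κ)) (hN : x0 ≤ Fintype.card n * η)
    (z : n → ℝ) (hz0 : ∀ k, 0 ≤ z k)
    (h1 : ∀ k, 1 / Yk k H E η ≤ 8 / c * (1 + z k))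
    (h2 : ∀ k, bad (c / 4) (κ / 16) k H E η → 1 ≤ z k)
    (h3 : ∀ k, c / 4 ≤ Tp k H E η)
    (hδ' : δ' = κ / (16 * (1 + (3 + 16 / c) * (8 / c))))
    (hZ : (∑ k, z k) / Fintype.card n ≤ δ') :
    c ≤ ((res H E η).trace / Fintype.card n).im := by
  set N : ℝ := (Fintype.card n : ℝ) with hNdef
  have hNpos : 0 < N := by rw [hNdef]; exact_mod_cast Fintype.card_pos
  set m : ℂ := (res H E η).trace / Fintype.card n with hm
  set ζ : ℂ := (E : ℂ) + η * Complex.I with hζ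
  set C := (1 + (3 + 16 / c) * (8 / c)) with hC
  have hCpos : 1 ≤ C := by rw [hC]; have : 0 < (3 + 16 / c) * (8 / c) := by positivity
                           linarith
  have hδ1 : δ' ≤ 1 := by
    rw [hδ', div_le_one (by positivity)]; linarith
  have hY : ∀ k, 0 < Yk k H E η := fun k => hη.trans_le (Yk_pos k H E hη)
  have hG : ∀ k, ‖res H E η k k‖ ≤ 1 / Yk k H E η := fun k => by
    rw [schur_kk hH k E hη, norm_inv, one_div]
    exact inv_anti₀ (hY k) (Yk_le_den hH k E hη)
  have hmN : m * (N : ℂ) = ∑ k, res H E η k k := by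
    have : (N : ℂ) ≠ 0 := by exact_mod_cast hNpos.ne'
    have e : ((Fintype.card n : ℕ) : ℂ) = (N : ℂ) := by simp [hNdef]
    rw [hm, e, div_mul_cancel₀ _ this]; rfl
  have hsum1 : ∑ k : n, (1 : ℝ) = N := by simp [hNdef]
  have hZ' : ∑ k, z k ≤ δ' * N := by rwa [div_le_iff₀ hNpos] at hZ
  have hmb : ‖m‖ ≤ 16 / c := by
    have : ‖m‖ * N ≤ 16 / c * N := by
      calc ‖m‖ * N = ‖m * (N : ℂ)‖ := by rw [norm_mul, Complex.norm_real, Real.norm_of_nonneg hNpos.le]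
        _ ≤ ∑ k, ‖res H E η k k‖ := by rw [hmN]; exact norm_sum_le _ _
        _ ≤ ∑ k, 8 / c * (1 + z k) := Finset.sum_le_sum fun k _ => (hG k).trans (h1 k)
        _ = 8 / c * (N + ∑ k, z k) := by rw [← Finset.mul_sum, Finset.sum_add_distrib, hsum1]
        _ ≤ 8 / c * (N + 1 * N) := by gcongr; exact hZ'.trans (by gcongr)
        _ = 16 / c * N := by ring
    exact le_of_mul_le_mul_right this hNpos
  have hζb : ‖ζ‖ ≤ 3 := by
    have hE2 : |E| ≤ 2 := abs_le_of_sq_le_sq (by nlinarith) (by norm_num)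
    calc ‖ζ‖ ≤ ‖(E : ℂ)‖ + ‖(η : ℂ) * Complex.I‖ := norm_add_le _ _
      _ = |E| + η := by simp [abs_of_pos hη]
      _ ≤ 3 := by linarith
  have hmim : 0 ≤ m.im := by
    rw [hm, ← Complex.ofReal_natCast, Complex.div_ofReal_im, trace_im hH E hη]
    have := Finset.sum_nonneg fun j (_ : j ∈ Finset.univ) => nsq_nonneg (res H E η *ᵥ (Pi.single j 1 : n → ℂ))
    positivity
  have hterm : ∀ k, ‖1 + (ζ + m) * res H E η k k‖ ≤ κ / 4 + 2 * C * z k := by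
    intro k
    by_cases hb : bad (c / 4) (κ / 16) k H E η
    · have hz1 := h2 k hb
      calc ‖1 + (ζ + m) * res H E η k k‖ ≤ 1 + (3 + 16 / c) * (8 / c * (1 + z k)) := by
            refine (norm_add_le _ _).trans ?_
            rw [norm_one, norm_mul]
            gcongr
            · exact (norm_add_le _ _).trans (by gcongr)
            · exact (hG k).trans (h1 k)
        _ ≤ C * (1 + z k) := by rw [hC]; nlinarith [hz0 k]
        _ ≤ κ / 4 + 2 * C * z k := by nlinarith
    · have hO : ‖Om k H E η‖ ≤ κ / 16 * Tp k H E η := by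
        by_contra hcon
        exact hb ⟨h3 k, not_le.1 hcon⟩
      have hTpos : 0 < Tp k H E η := lt_of_lt_of_le (by positivity) (h3 k)
      have hYT := good_Y hH k E hη hTpos.le (by linarith) hO
      have hid : 1 + (ζ + m) * res H E η k k
          = (den k H E η)⁻¹ * (Om k H E η + (m - ptr k H E η / Fintype.card n)) := by
        have hd := den_ne hH k E hη
        rw [schur_kk hH k E hη]
        have : den k H E η = Om k H E η - ζ - ptr k H E η / Fintype.card n := by unfold den Om; ring
        have h5 : (Om k H E η + (m - ptr k H E η / Fintype.card n)) = den k H E η + (ζ + m) := by rw [this]; ring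
        rw [h5, mul_add, inv_mul_cancel₀ hd, mul_comm]
      have hdiff : ‖m - ptr k H E η / Fintype.card n‖ ≤ c * κ / 64 := by
        rw [hm, ← sub_div, norm_div]
        have := trace_diff hH k E hη
        have e : ‖((Fintype.card n : ℕ) : ℂ)‖ = N := by simp [hNdef]
        rw [e]
        calc _ ≤ (1 / η) / N := by gcongr
          _ = 1 / (N * η) := by rw [div_div, mul_comm]
          _ ≤ 1 / x0 := by
            apply one_div_le_one_div_of_le _ hN
            rw [hx0]; positivity
          _ = _ := by rw [hx0]; field_simp
      rw [hid, norm_mul, norm_inv]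
      have hden : ‖den k H E η‖⁻¹ ≤ 2 / Tp k H E η := by
        rw [← inv_div]
        exact inv_anti₀ (by positivity) (hYT.trans (Yk_le_den hH k E hη))
      calc _ ≤ 2 / Tp k H E η * (κ / 16 * Tp k H E η + c * κ / 64) := by
            gcongr
            exact (norm_add_le _ _).trans (by gcongr)
        _ ≤ 2 / Tp k H E η * (κ / 16 * Tp k H E η + Tp k H E η * κ / 16) := by
            have h4 : c * κ / 64 ≤ Tp k H E η * κ / 16 := by
              have := h3 k
              nlinarith
            gcongr
        _ = κ / 4 := by field_simp; ring
        _ ≤ _ := by have := hz0 k; have : 0 ≤ 2 * C * z k := by positivity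
                    linarith
  set ε := m * m + ζ * m + 1 with hε
  have hεN : ε * N = ∑ k, (1 + (ζ + m) * res H E η k k) := by
    rw [Finset.sum_add_distrib, ← Finset.mul_sum, ← hmN, hε]
    have : ∑ k : n, (1 : ℂ) = N := by simp [hNdef]
    rw [this]; ring
  have hεb : ‖ε‖ ≤ κ / 2 := by
    have : ‖ε‖ * N ≤ κ / 2 * N := by
      calc ‖ε‖ * N = ‖ε * (N : ℂ)‖ := by rw [norm_mul, Complex.norm_real, Real.norm_of_nonneg hNpos.le]
        _ ≤ ∑ k, (κ / 4 + 2 * C * z k) := by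
            rw [hεN]; exact (norm_sum_le _ _).trans (Finset.sum_le_sum fun k _ => hterm k)
        _ = κ / 4 * N + 2 * C * ∑ k, z k := by
            rw [Finset.sum_add_distrib, ← Finset.mul_sum, ← hsum1, Finset.mul_sum]; simp; ring
        _ ≤ κ / 4 * N + 2 * C * (δ' * N) := by gcongr
        _ = κ / 4 * N + κ / 8 * N := by rw [hδ']; field_simp; ring
        _ ≤ κ / 2 * N := by nlinarith
    exact le_of_mul_le_mul_right this hNpos
  exact selfcons hmim hη hη2 hc hcκ hE hεb hε.symm

open scoped Classical in
/-- dyadic bookkeeping -/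
def zrec (f : ℕ → Prop) : ℕ → ℝ
  | 0 => if f 0 then 1 else 0
  | j + 1 => 2 * zrec f j + if f (j + 1) then 1 else 0

theorem zrec_nonneg (f : ℕ → Prop) (j : ℕ) : 0 ≤ zrec f j := by
  induction j with
  | zero => simp only [zrec]; split_ifs <;> norm_num
  | succ j ih => simp only [zrec]; split_ifs <;> linarith

theorem zrec_one {f : ℕ → Prop} {j : ℕ} (h : f j) : 1 ≤ zrec f j := by
  cases j with
  | zero => simp [zrec, h]
  | succ j => have := zrec_nonneg f j; simp [zrec, h]; exact this

open scoped Classical in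
theorem zrec_sum (f : ℕ → Prop) (j : ℕ) :
    zrec f j = ∑ i ∈ Finset.range (j + 1), 2 ^ (j - i) * (if f i then (1 : ℝ) else 0) := by
  induction j with
  | zero => rw [zero_add, Finset.sum_range_one, Nat.sub_self, pow_zero, one_mul]; rfl
  | succ j ih =>
    rw [Finset.sum_range_succ, zrec, ih, Finset.mul_sum]
    simp only [Nat.sub_self, pow_zero, one_mul]
    congr 1
    refine Finset.sum_congr rfl fun i hi => ?_
    have : j + 1 - i = (j - i) + 1 := by have := Finset.mem_range.1 hi; omega
    rw [this, pow_succ]; ring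

theorem zrec_cases (f : ℕ → Prop) (j : ℕ) :
    zrec f j = 0 ∨ ∃ i ≤ j, f i ∧ 1 + zrec f j ≤ 2 * 2 ^ (j - i) := by
  induction j with
  | zero => by_cases h : f 0 <;> simp [zrec, h]; norm_num
  | succ j ih =>
    rcases ih with h0 | ⟨i, hij, hi, hle⟩
    · by_cases h : f (j + 1)
      · right; exact ⟨j + 1, le_rfl, h, by simp [zrec, h, h0]; norm_num⟩
      · left; simp [zrec, h, h0]
    · right
      refine ⟨i, by omega, hi, ?_⟩
      have : j + 1 - i = (j - i) + 1 := by omega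
      rw [this, pow_succ, zrec]
      split_ifs <;> linarith

open scoped Classical in
theorem zrec_pow (f : ℕ → Prop) (j : ℕ) {q : ℝ} (hq : 0 ≤ q) :
    (1 + zrec f j) ^ q ≤ 1 + ∑ i ∈ Finset.range (j + 1), (2 * 2 ^ (j - i) : ℝ) ^ q * (if f i then (1 : ℝ) else 0) := by
  have hnn : ∀ i ∈ Finset.range (j + 1), 0 ≤ (2 * 2 ^ (j - i) : ℝ) ^ q * (if f i then (1 : ℝ) else 0) := by
    intro i _
    split_ifs <;> positivity
  rcases zrec_cases f j with h | ⟨i, hij, hi, hle⟩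
  · rw [h]; simp only [add_zero, Real.one_rpow]
    have := Finset.sum_nonneg hnn
    linarith
  · have h1 := Finset.single_le_sum hnn (Finset.mem_range.2 (Nat.lt_succ_of_le hij))
    have h2 : (1 + zrec f j) ^ q ≤ (2 * 2 ^ (j - i) : ℝ) ^ q :=
      Real.rpow_le_rpow (by have := zrec_nonneg f j; linarith) hle hq
    simp only [hi, if_true, mul_one] at h1
    linarith

theorem scales [Nonempty n] {H : Matrix n n ℂ} (hH : H.IsHermitian) {E κ c x0 δ' : ℝ} (J : ℕ)
    (hc : 0 < c) (hc1 : c ≤ 1 / 2) (hκ : 0 < κ) (hκ1 : κ ≤ 1)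
    (hcκ : 4 * c ^ 2 ≤ κ / 2) (hE : E ^ 2 / 4 ≤ 1 - κ)
    (hx0 : x0 = 64 / (c * κ)) (hN : x0 ≤ Fintype.card n * (2 * c / 2 ^ J))
    (hδ' : δ' = κ / (16 * (1 + (3 + 16 / c) * (8 / c))))
    (hZ : ∀ j ≤ J, (∑ k, zrec (fun i => bad (c / 4) (κ / 16) k H E (2 * c / 2 ^ i)) j) / Fintype.card n ≤ δ') :
    ∀ j ≤ J, c ≤ ((res H E (2 * c / 2 ^ j)).trace / Fintype.card n).im ∧
      ∀ k, 1 / Yk k H E (2 * c / 2 ^ j) ≤ 8 / c * (1 + zrec (fun i => bad (c / 4) (κ / 16) k H E (2 * c / 2 ^ i)) j) := by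
  have hNpos : (0 : ℝ) < Fintype.card n := by exact_mod_cast Fintype.card_pos
  have hηpos : ∀ j : ℕ, 0 < 2 * c / 2 ^ j := fun j => by positivity
  have hηle : ∀ j : ℕ, 2 * c / 2 ^ j ≤ 2 * c := fun j => div_le_self (by positivity) (one_le_pow₀ (by norm_num))
  have hNj : ∀ j ≤ J, x0 ≤ Fintype.card n * (2 * c / 2 ^ j) := fun j hj => hN.trans (by gcongr; norm_num)
  have core : ∀ j ≤ J, (∀ k, c / 4 ≤ Tp k H E (2 * c / 2 ^ j)) →
      (∀ k, 1 / Yk k H E (2 * c / 2 ^ j) ≤ 8 / c * (1 + zrec (fun i => bad (c / 4) (κ / 16) k H E (2 * c / 2 ^ i)) j)) →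
      c ≤ ((res H E (2 * c / 2 ^ j)).trace / Fintype.card n).im := by
    intro j hj hT hY
    exact main_step hH (hηpos j) (hηle j) hc hc1 hκ hκ1 hcκ hE hx0 (hNj j hj) _ (fun k => zrec_nonneg _ j) hY
      (fun k hk => zrec_one (f := fun i => bad (c / 4) (κ / 16) k H E (2 * c / 2 ^ i)) hk) hT hδ' (hZ j hj)
  have goodY : ∀ (j : ℕ) (k : n), c / 4 ≤ Tp k H E (2 * c / 2 ^ j) → ¬ bad (c / 4) (κ / 16) k H E (2 * c / 2 ^ j) →
      1 / Yk k H E (2 * c / 2 ^ j) ≤ 8 / c := by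
    intro j k hT hb
    have hO : ‖Om k H E (2 * c / 2 ^ j)‖ ≤ κ / 16 * Tp k H E (2 * c / 2 ^ j) := by
      by_contra hcon
      exact hb ⟨hT, not_le.1 hcon⟩
    have := good_Y hH k E (hηpos j) (by linarith) (by linarith) hO
    rw [show 8 / c = 1 / (c / 8) by field_simp]
    apply one_div_le_one_div_of_le (by positivity)
    linarith
  have Tnn : ∀ (k : n) {η : ℝ}, 0 < η → 0 ≤ (ptr k H E η).im := by
    intro k η hη
    rw [ptr_im hH k E hη]
    exact mul_nonneg hη.le (Finset.sum_nonneg fun i _ => Finset.sum_nonneg fun j _ => by positivity)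
  intro j
  induction j with
  | zero =>
    intro hj
    have hT : ∀ k, c / 4 ≤ Tp k H E (2 * c / 2 ^ 0) := by
      intro k
      have := Tnn k (hηpos 0)
      have : 0 ≤ (ptr k H E (2 * c / 2 ^ 0)).im / Fintype.card n := by positivity
      unfold Tp
      simp at this ⊢
      linarith
    have hY : ∀ k, 1 / Yk k H E (2 * c / 2 ^ 0) ≤
        8 / c * (1 + zrec (fun i => bad (c / 4) (κ / 16) k H E (2 * c / 2 ^ i)) 0) := by
      intro k
      have h1 : 1 / Yk k H E (2 * c / 2 ^ 0) ≤ 1 / (2 * c / 2 ^ 0) :=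
        one_div_le_one_div_of_le (hηpos 0) (Yk_pos k H E (hηpos 0))
      have h2 : 1 / (2 * c / 2 ^ 0) ≤ 8 / c := by
        simp only [pow_zero, div_one]
        rw [div_le_div_iff₀ (by positivity) hc]; linarith
      have h3 := zrec_nonneg (fun i => bad (c / 4) (κ / 16) k H E (2 * c / 2 ^ i)) 0
      have h4 : 0 < 8 / c := by positivity
      nlinarith
    exact ⟨core 0 hj hT hY, hY⟩
  | succ j ih =>
    intro hj
    obtain ⟨ihm, ihY⟩ := ih (by omega)
    have hhalf : 2 * c / 2 ^ (j + 1) = (2 * c / 2 ^ j) / 2 := by rw [pow_succ]; field_simp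
    have hT : ∀ k, c / 4 ≤ Tp k H E (2 * c / 2 ^ (j + 1)) := by
      intro k
      have h1 := trace_half hH E (hηpos j)
      rw [← hhalf] at h1
      have h2 := trace_diff hH k E (hηpos (j + 1))
      have h3 := (Complex.abs_im_le_norm _).trans h2
      rw [Complex.sub_im] at h3
      have h4 := (abs_le.1 h3).2
      rw [← Complex.ofReal_natCast, Complex.div_ofReal_im, le_div_iff₀ (by exact_mod_cast hNpos)] at ihm
      have h5 : 1 / (2 * c / 2 ^ (j + 1)) ≤ c / 4 * Fintype.card n := by
        rw [div_le_iff₀ (hηpos _)]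
        have := hNj (j + 1) hj
        have h6 : 4 / c ≤ x0 := by
          rw [hx0, div_le_div_iff₀ hc (by positivity)]
          nlinarith
        rw [mul_assoc]
        calc (1 : ℝ) = c / 4 * (4 / c) := by field_simp
          _ ≤ _ := by gcongr; exact h6.trans this
      have h7 : c / 4 ≤ (ptr k H E (2 * c / 2 ^ (j + 1))).im / Fintype.card n := by
        rw [le_div_iff₀ hNpos]
        linarith
      have := hηpos (j + 1)
      unfold Tp
      linarith
    have hY : ∀ k, 1 / Yk k H E (2 * c / 2 ^ (j + 1)) ≤
        8 / c * (1 + zrec (fun i => bad (c / 4) (κ / 16) k H E (2 * c / 2 ^ i)) (j + 1)) := by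
      intro k
      have h0 : 0 < 8 / c := by positivity
      by_cases hb : bad (c / 4) (κ / 16) k H E (2 * c / 2 ^ (j + 1))
      · have h1 := Yk_half hH k E (hηpos j)
        rw [← hhalf] at h1
        have hp := (hηpos j).trans_le (Yk_pos k H E (hηpos j))
        have hp1 := (hηpos (j+1)).trans_le (Yk_pos k H E (hηpos (j+1)))
        have h2 : 1 / Yk k H E (2 * c / 2 ^ (j + 1)) ≤ 2 * (1 / Yk k H E (2 * c / 2 ^ j)) := by
          rw [mul_one_div, div_le_div_iff₀ hp1 hp]; linarith
        have h3 := ihY k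
        simp only [zrec, if_pos hb]
        nlinarith
      · have h1 := goodY (j + 1) k (hT k) hb
        have h3 := zrec_nonneg (fun i => bad (c / 4) (κ / 16) k H E (2 * c / 2 ^ i)) (j + 1)
        nlinarith
    exact ⟨core (j + 1) hj hT hY, hY⟩

end Det

section Conc

/-- centered law on the plane with a Gaussian moment -/
def SG (δ D : ℝ) (μ : Measure ℂ) : Prop :=
  IsProbabilityMeasure μ ∧ (∫ z, z ∂μ) = 0 ∧
    (∫⁻ z, ENNReal.ofReal (Real.exp (δ * ‖z‖ ^ 2)) ∂μ) ≤ ENNReal.ofReal D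

theorem exp_quad (y : ℝ) : Real.exp y ≤ 1 + y + y ^ 2 * Real.exp |y| := by
  have h := Complex.norm_exp_sub_sum_le_norm_mul_exp (y : ℂ) 2
  simp only [Finset.sum_range_succ, Finset.sum_range_zero, pow_zero, Nat.factorial, pow_one] at h
  have h2 : Complex.exp (y : ℂ) - (0 + 1 / ((1 : ℕ) : ℂ) + (y : ℂ) / ((Nat.succ 0 * 1 : ℕ) : ℂ)) =
      ((Real.exp y - (1 + y) : ℝ) : ℂ) := by
    push_cast; norm_num
  rw [h2, Complex.norm_real, Complex.norm_real, Real.norm_eq_abs, Real.norm_eq_abs, sq_abs] at h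
  have := le_abs_self (Real.exp y - (1 + y))
  linarith

theorem sg_int {δ D : ℝ} {μ : Measure ℂ} (h : SG δ D μ) :
    Integrable (fun z : ℂ => Real.exp (δ * ‖z‖ ^ 2)) μ ∧
      (∫ z, Real.exp (δ * ‖z‖ ^ 2) ∂μ) ≤ D ∧ 0 < D := by
  obtain ⟨h1, h2, h3⟩ := h
  have hm : AEStronglyMeasurable (fun z : ℂ => Real.exp (δ * ‖z‖ ^ 2)) μ := by
    apply Continuous.aestronglyMeasurable; fun_prop
  have hi : Integrable (fun z : ℂ => Real.exp (δ * ‖z‖ ^ 2)) μ := by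
    refine ⟨hm, ?_⟩
    rw [hasFiniteIntegral_iff_ofReal (ae_of_all _ fun z => (Real.exp_pos _).le)]
    exact h3.trans_lt ENNReal.ofReal_lt_top
  rw [← ofReal_integral_eq_lintegral_ofReal hi (ae_of_all _ fun z => (Real.exp_pos _).le)] at h3
  have hpos : 0 < ∫ z, Real.exp (δ * ‖z‖ ^ 2) ∂μ := integral_exp_pos hi
  have hD : 0 < D := by
    by_contra hD
    rw [ENNReal.ofReal_of_nonpos (not_lt.1 hD)] at h3
    have := ENNReal.ofReal_pos.2 hpos
    exact absurd h3 (not_le.2 this)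
  exact ⟨hi, (ENNReal.ofReal_le_ofReal_iff hD.le).1 h3, hD⟩

theorem sg_sq {δ D : ℝ} (hδ : 0 < δ) {μ : Measure ℂ} (h : SG δ D μ) :
    Integrable (fun z : ℂ => ‖z‖ ^ 2) μ ∧ Integrable (fun z : ℂ => z) μ ∧
      δ * (∫ z, ‖z‖ ^ 2 ∂μ) ≤ D := by
  obtain ⟨hi, hle, hD⟩ := sg_int h
  have := h.1
  have h1 : Integrable (fun z : ℂ => ‖z‖ ^ 2) μ := by
    refine Integrable.mono' (hi.const_mul (1 / δ)) (by apply Continuous.aestronglyMeasurable; fun_prop)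
      (ae_of_all _ fun z => ?_)
    rw [Real.norm_of_nonneg (by positivity), one_div, inv_mul_eq_div, le_div_iff₀ hδ]
    linarith [Real.add_one_le_exp (δ * ‖z‖ ^ 2)]
  refine ⟨h1, ?_, ?_⟩
  · refine Integrable.mono' (h1.add (integrable_const 1)) (by apply Continuous.aestronglyMeasurable; fun_prop)
      (ae_of_all _ fun z => ?_)
    simp only [Pi.add_apply]
    nlinarith [sq_nonneg (‖z‖ - 1)]
  · rw [← integral_const_mul]
    refine le_trans (integral_mono (h1.const_mul δ) hi fun z => ?_) hle
    simp only
    linarith [Real.add_one_le_exp (δ * ‖z‖ ^ 2)]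

theorem mgf_point {δ D a σ r y b : ℝ} (hδ : 0 < δ) (ha : |a| ≤ δ / 4) (hσ : 0 ≤ σ) (hσD : δ * σ ≤ D)
    (hy : |y| ≤ b * r) :
    Real.exp (a * (r ^ 2 - σ) + y) ≤ 1 + (a * (r ^ 2 - σ) + y) +
      (2 * (a ^ 2 + b ^ 2) * (Real.exp (D / 4) * Real.exp (b ^ 2 / δ)) *
        (16 / δ ^ 2 + 2 * D ^ 2 / δ ^ 2 + 2 / δ)) * Real.exp (δ * r ^ 2) := by
  set Y := a * (r ^ 2 - σ) + y with hY
  refine (exp_quad Y).trans ?_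
  have hD : 0 ≤ D := by nlinarith
  have e1 : |Y| ≤ δ * r ^ 2 / 2 + D / 4 + b ^ 2 / δ := by
    have : |Y| ≤ |a| * (r ^ 2 + σ) + b * r := by
      refine (abs_add_le _ _).trans (add_le_add ?_ hy)
      rw [abs_mul]
      apply mul_le_mul_of_nonneg_left _ (abs_nonneg _)
      rw [abs_le]; constructor <;> nlinarith [sq_nonneg r]
    have h2 : |a| * (r ^ 2 + σ) ≤ δ / 4 * (r ^ 2 + σ) :=
      mul_le_mul_of_nonneg_right ha (by positivity)
    have h3 : b * r ≤ δ * r ^ 2 / 4 + b ^ 2 / δ := by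
      have : δ * r ^ 2 / 4 + b ^ 2 / δ - b * r = (δ * r / 2 - b) ^ 2 / δ := by field_simp; ring
      have : 0 ≤ (δ * r / 2 - b) ^ 2 / δ := by positivity
      linarith
    nlinarith
  have e2 : Y ^ 2 ≤ 2 * (a ^ 2 + b ^ 2) * ((r ^ 2 + σ) ^ 2 + r ^ 2) := by
    have y2 : y ^ 2 ≤ b ^ 2 * r ^ 2 := by
      have := pow_le_pow_left₀ (abs_nonneg y) hy 2
      rw [sq_abs] at this; nlinarith
    have h1 : Y ^ 2 ≤ 2 * (a * (r ^ 2 - σ)) ^ 2 + 2 * y ^ 2 := by nlinarith [sq_nonneg (a * (r ^ 2 - σ) - y)]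
    have h2 : (r ^ 2 - σ) ^ 2 ≤ (r ^ 2 + σ) ^ 2 := by nlinarith [mul_nonneg (sq_nonneg r) hσ]
    have h3 : a ^ 2 * (r ^ 2 - σ) ^ 2 ≤ a ^ 2 * (r ^ 2 + σ) ^ 2 := mul_le_mul_of_nonneg_left h2 (sq_nonneg a)
    nlinarith [mul_nonneg (sq_nonneg a) (sq_nonneg r), mul_nonneg (sq_nonneg b) (sq_nonneg (r ^ 2 + σ))]
  set t := δ * r ^ 2 / 2 with ht
  have ht0 : 0 ≤ t := by positivity
  have e3 : (r ^ 2 + σ) ^ 2 + r ^ 2 ≤ (16 / δ ^ 2 + 2 * D ^ 2 / δ ^ 2 + 2 / δ) * Real.exp t := by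
    have hr2 : r ^ 2 = 2 * t / δ := by rw [ht]; field_simp
    have hs : σ ≤ D / δ := by rw [le_div_iff₀ hδ]; linarith
    have t1 : t ≤ Real.exp t := by linarith [Real.add_one_le_exp t]
    have t2 : t ^ 2 ≤ 2 * Real.exp t := by
      have := Real.quadratic_le_exp_of_nonneg ht0; nlinarith
    have t3 : 1 ≤ Real.exp t := Real.one_le_exp ht0
    calc (r ^ 2 + σ) ^ 2 + r ^ 2 ≤ 2 * (r ^ 2) ^ 2 + 2 * σ ^ 2 + r ^ 2 := by nlinarith [sq_nonneg (r ^ 2 - σ)]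
      _ ≤ 2 * (r ^ 2) ^ 2 + 2 * (D / δ) ^ 2 + r ^ 2 := by gcongr
      _ = 8 / δ ^ 2 * t ^ 2 + 2 * D ^ 2 / δ ^ 2 * 1 + 2 / δ * t := by rw [hr2]; field_simp; ring
      _ ≤ 8 / δ ^ 2 * (2 * Real.exp t) + 2 * D ^ 2 / δ ^ 2 * Real.exp t + 2 / δ * Real.exp t := by gcongr
      _ = _ := by ring
  have e4 : Real.exp |Y| ≤ Real.exp t * (Real.exp (D / 4) * Real.exp (b ^ 2 / δ)) := by
    rw [← Real.exp_add, ← Real.exp_add]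
    apply Real.exp_le_exp.2; linarith
  have e5 : Real.exp (δ * r ^ 2) = Real.exp t * Real.exp t := by
    rw [← Real.exp_add]; congr 1; rw [ht]; ring
  have : Y ^ 2 * Real.exp |Y| ≤ (2 * (a ^ 2 + b ^ 2) * ((16 / δ ^ 2 + 2 * D ^ 2 / δ ^ 2 + 2 / δ) * Real.exp t)) *
      (Real.exp t * (Real.exp (D / 4) * Real.exp (b ^ 2 / δ))) := by
    apply mul_le_mul _ e4 (Real.exp_pos _).le (by positivity)
    exact e2.trans (mul_le_mul_of_nonneg_left e3 (by positivity))
  rw [e5]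
  nlinarith

theorem mgf_one (δ D : ℝ) (hδ : 0 < δ) : ∃ C : ℝ, 1 ≤ C ∧ ∀ μ : Measure ℂ, SG δ D μ → ∀ (a : ℝ) (β : ℂ),
    |a| ≤ δ / 4 → ∫⁻ z, ENNReal.ofReal (Real.exp (a * (‖z‖ ^ 2 - ∫ w, ‖w‖ ^ 2 ∂μ) + (β * z).re)) ∂μ
      ≤ ENNReal.ofReal (Real.exp (C * (a ^ 2 + ‖β‖ ^ 2))) := by
  set C3 := 2 * Real.exp (D / 4) * (16 / δ ^ 2 + 2 * D ^ 2 / δ ^ 2 + 2 / δ) * |D| with hC3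
  refine ⟨C3 + 1 / δ + 1, ?_, ?_⟩
  · have : 0 ≤ C3 := by positivity
    have : 0 < 1 / δ := by positivity
    linarith
  intro μ hμ a β ha
  have hp := hμ.1
  obtain ⟨hi, hle, hD⟩ := sg_int hμ
  obtain ⟨hs1, hs2, hs3⟩ := sg_sq hδ hμ
  set σ := ∫ w, ‖w‖ ^ 2 ∂μ with hσ
  have hσ0 : 0 ≤ σ := integral_nonneg fun _ => by positivity
  set G := (2 * (a ^ 2 + ‖β‖ ^ 2) * (Real.exp (D / 4) * Real.exp (‖β‖ ^ 2 / δ)) *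
        (16 / δ ^ 2 + 2 * D ^ 2 / δ ^ 2 + 2 / δ)) with hG
  have hpt : ∀ z : ℂ, Real.exp (a * (‖z‖ ^ 2 - σ) + (β * z).re) ≤ 1 + (a * (‖z‖ ^ 2 - σ) + (β * z).re) +
      G * Real.exp (δ * ‖z‖ ^ 2) := fun z =>
    mgf_point hδ ha hσ0 hs3
      ((Complex.abs_re_le_norm _).trans (norm_mul_le _ _))
  have hre : Integrable (fun z : ℂ => (β * z).re) μ := (hs2.const_mul β).re
  have hI3 : Integrable (fun z : ℂ => a * (‖z‖ ^ 2 - σ)) μ :=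
    (hs1.sub (integrable_const σ)).const_mul a
  have hI2 : Integrable (fun z : ℂ => a * (‖z‖ ^ 2 - σ) + (β * z).re) μ := hI3.add hre
  have hI1 : Integrable (fun z : ℂ => 1 + (a * (‖z‖ ^ 2 - σ) + (β * z).re)) μ :=
    (integrable_const 1).add hI2
  have hI : Integrable (fun z : ℂ => 1 + (a * (‖z‖ ^ 2 - σ) + (β * z).re) +
      G * Real.exp (δ * ‖z‖ ^ 2)) μ := hI1.add (hi.const_mul G)
  refine (lintegral_mono fun z => ENNReal.ofReal_le_ofReal (hpt z)).trans ?_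
  rw [← ofReal_integral_eq_lintegral_ofReal hI (ae_of_all _ fun z => (Real.exp_pos _).le.trans (hpt z))]
  apply ENNReal.ofReal_le_ofReal
  have hzero : ∫ z, (β * z).re ∂μ = 0 := by
    have := integral_re (𝕜 := ℂ) (hs2.const_mul β)
    simp only [RCLike.re_to_complex] at this
    rw [this, integral_const_mul, hμ.2.1]; simp
  have hval : ∫ z, (1 + (a * (‖z‖ ^ 2 - σ) + (β * z).re) + G * Real.exp (δ * ‖z‖ ^ 2)) ∂μ =
      1 + G * ∫ z, Real.exp (δ * ‖z‖ ^ 2) ∂μ := by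
    rw [integral_add hI1 (hi.const_mul G), integral_add (integrable_const 1) hI2,
      integral_add hI3 hre, integral_const_mul, integral_const_mul,
      integral_sub hs1 (integrable_const σ), hzero]
    simp [← hσ]
  rw [hval]
  have hG0 : 0 ≤ G := by positivity
  set s := a ^ 2 + ‖β‖ ^ 2 with hs
  have hs0 : 0 ≤ s := by positivity
  have b1 : G * ∫ z, Real.exp (δ * ‖z‖ ^ 2) ∂μ ≤ G * |D| :=
    mul_le_mul_of_nonneg_left (hle.trans (le_abs_self _)) hG0
  have b2 : G * |D| = C3 * s * Real.exp (‖β‖ ^ 2 / δ) := by rw [hG, hC3]; ring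
  have b3 : 1 ≤ Real.exp (‖β‖ ^ 2 / δ) := Real.one_le_exp (by positivity)
  have b4 : C3 * s + 1 ≤ Real.exp (C3 * s) := Real.add_one_le_exp _
  calc 1 + G * ∫ z, Real.exp (δ * ‖z‖ ^ 2) ∂μ ≤ (C3 * s + 1) * Real.exp (‖β‖ ^ 2 / δ) := by nlinarith
    _ ≤ Real.exp (C3 * s) * Real.exp (‖β‖ ^ 2 / δ) := by gcongr
    _ = Real.exp (C3 * s + ‖β‖ ^ 2 / δ) := by rw [Real.exp_add]
    _ ≤ _ := by
      apply Real.exp_le_exp.2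
      have : ‖β‖ ^ 2 / δ ≤ 1 / δ * s := by
        rw [div_mul_eq_mul_div, one_mul]; gcongr; nlinarith [sq_nonneg a]
      nlinarith
end Conc

section Conc2

theorem lint_cons {n : ℕ} (μ : Fin (n + 1) → Measure ℂ) [∀ i, IsProbabilityMeasure (μ i)]
    (f : (Fin (n + 1) → ℂ) → ℝ≥0∞) (hf : Measurable f) :
    ∫⁻ z, f z ∂Measure.pi μ =
      ∫⁻ y, ∫⁻ x, f (Fin.cons x y) ∂μ 0 ∂Measure.pi (fun j => μ (Fin.succ j)) := by
  have h := (measurePreserving_piFinSuccAbove (α := fun _ => ℂ) μ 0).symm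
  rw [← h.lintegral_comp hf]
  refine (lintegral_prod_symm' _ (hf.comp h.measurable)).trans ?_
  simp only [Function.comp_apply, Fin.succAbove_zero]
  refine lintegral_congr fun y => lintegral_congr fun x => ?_
  congr 1
  simp [MeasurableEquiv.piFinSuccAbove, Fin.consEquiv]

theorem lin_mgf {δ C : ℝ} (hδ : 0 < δ) (S : Measure ℂ → Prop) (hS : ∀ μ, S μ → IsProbabilityMeasure μ)
    (hC : ∀ μ : Measure ℂ, S μ → ∀ (a : ℝ) (β : ℂ),
    |a| ≤ δ / 4 → ∫⁻ z, ENNReal.ofReal (Real.exp (a * (‖z‖ ^ 2 - ∫ w, ‖w‖ ^ 2 ∂μ) + (β * z).re)) ∂μ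
      ≤ ENNReal.ofReal (Real.exp (C * (a ^ 2 + ‖β‖ ^ 2)))) :
    ∀ (n : ℕ) (μ : Fin n → Measure ℂ), (∀ i, S (μ i)) → ∀ β : Fin n → ℂ,
    ∫⁻ z, ENNReal.ofReal (Real.exp ((∑ i, β i * z i).re)) ∂Measure.pi μ
      ≤ ENNReal.ofReal (Real.exp (C * ∑ i, ‖β i‖ ^ 2)) := by
  intro n
  induction n with
  | zero =>
    intro μ hμ β
    simp
  | succ n ih =>
    intro μ hμ β
    have := fun i => hS _ (hμ i)
    rw [lint_cons μ _ (by fun_prop)]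
    calc _ ≤ ∫⁻ y : Fin n → ℂ, ENNReal.ofReal (Real.exp (C * ‖β 0‖ ^ 2)) *
          ENNReal.ofReal (Real.exp ((∑ i : Fin n, β i.succ * y i).re)) ∂Measure.pi (fun j => μ (Fin.succ j)) := by
          refine lintegral_mono fun y => ?_
          have h0 := hC _ (hμ 0) 0 (β 0) (by simp; positivity)
          have : ∀ x : ℂ, ENNReal.ofReal (Real.exp ((∑ i, β i * (Fin.cons x y : Fin (n + 1) → ℂ) i).re)) =
            ENNReal.ofReal (Real.exp (0 * (‖x‖ ^ 2 - ∫ w, ‖w‖ ^ 2 ∂μ 0) + (β 0 * x).re)) *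
             ENNReal.ofReal (Real.exp ((∑ i : Fin n, β i.succ * y i).re)) := by
            intro x
            rw [← ENNReal.ofReal_mul (Real.exp_pos _).le, ← Real.exp_add, Fin.sum_univ_succ]
            simp
          simp_rw [this]
          rw [lintegral_mul_const _ (by fun_prop)]
          gcongr
          simpa using h0
      _ ≤ _ := by
          rw [lintegral_const_mul _ (by fun_prop), Fin.sum_univ_succ, mul_add, Real.exp_add,
            ENNReal.ofReal_mul (Real.exp_pos _).le]
          gcongr
          exact ih _ (fun i => hμ i.succ) _

/-- row coefficient vectors -/
def rowb {n : ℕ} (A : Fin n → Fin n → ℂ) (i j : Fin n) : ℂ :=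
  if i < j then star (A i j) + A j i else 0

/-- linear forms -/
def Lf {n : ℕ} (A : Fin n → Fin n → ℂ) (i : Fin n) (z : Fin n → ℂ) : ℂ := ∑ j, rowb A i j * star (z j)

/-- centered quadratic form -/
def Qc {n : ℕ} (μ : Fin n → Measure ℂ) (A : Fin n → Fin n → ℂ) (z : Fin n → ℂ) : ℂ :=
  (∑ i, ∑ j, A i j * (star (z i) * z j)) - ∑ i, A i i * ((∫ w, ‖w‖ ^ 2 ∂μ i : ℝ) : ℂ)

/-- quadratic variation -/
def Vf {n : ℕ} (A : Fin n → Fin n → ℂ) (z : Fin n → ℂ) : ℝ := ∑ i, ((A i i).re ^ 2 + ‖Lf A i z‖ ^ 2)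

theorem Lf_cont {n : ℕ} (A : Fin n → Fin n → ℂ) (i : Fin n) : Continuous (Lf A i) := by
  unfold Lf; fun_prop
theorem Qc_cont {n : ℕ} (μ : Fin n → Measure ℂ) (A : Fin n → Fin n → ℂ) : Continuous (Qc μ A) := by
  unfold Qc; fun_prop
theorem Vf_cont {n : ℕ} (A : Fin n → Fin n → ℂ) : Continuous (Vf A) := by
  have := Lf_cont A
  unfold Vf; fun_prop

theorem Lf_zero {n : ℕ} (A : Fin (n + 1) → Fin (n + 1) → ℂ) (x : ℂ) (y : Fin n → ℂ) :
    Lf A 0 (Fin.cons x y) = ∑ j : Fin n, (star (A 0 j.succ) + A j.succ 0) * star (y j) := by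
  unfold Lf rowb
  rw [Fin.sum_univ_succ]
  simp [Fin.succ_pos]

theorem Lf_succ {n : ℕ} (A : Fin (n + 1) → Fin (n + 1) → ℂ) (x : ℂ) (y : Fin n → ℂ) (i : Fin n) :
    Lf A i.succ (Fin.cons x y) = Lf (fun i j => A i.succ j.succ) i y := by
  unfold Lf rowb
  rw [Fin.sum_univ_succ]
  simp

theorem Vf_cons {n : ℕ} (A : Fin (n + 1) → Fin (n + 1) → ℂ) (x : ℂ) (y : Fin n → ℂ) :
    Vf A (Fin.cons x y) = ((A 0 0).re ^ 2 + ‖∑ j : Fin n, (star (A 0 j.succ) + A j.succ 0) * star (y j)‖ ^ 2) +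
      Vf (fun i j => A i.succ j.succ) y := by
  unfold Vf
  rw [Fin.sum_univ_succ, Lf_zero]
  simp_rw [Lf_succ]

theorem Qc_cons {n : ℕ} (μ : Fin (n + 1) → Measure ℂ) (A : Fin (n + 1) → Fin (n + 1) → ℂ) (x : ℂ) (y : Fin n → ℂ) :
    (Qc μ A (Fin.cons x y)).re = ((A 0 0).re * (‖x‖ ^ 2 - ∫ w, ‖w‖ ^ 2 ∂μ 0) +
      ((∑ j : Fin n, (star (A 0 j.succ) + A j.succ 0) * star (y j)) * x).re) +
      (Qc (fun j => μ j.succ) (fun i j => A i.succ j.succ) y).re := by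
  unfold Qc
  simp_rw [Fin.sum_univ_succ, Fin.cons_zero, Fin.cons_succ]
  have h1 : (A 0 0 * (star x * x)).re = (A 0 0).re * ‖x‖ ^ 2 := by
    have : star x * x = ((‖x‖ ^ 2 : ℝ) : ℂ) := by
      rw [Complex.star_def, mul_comm, Complex.mul_conj, Complex.normSq_eq_norm_sq]
    rw [this, Complex.re_mul_ofReal]
  have h2 : ((∑ j : Fin n, (star (A 0 j.succ) + A j.succ 0) * star (y j)) * x).re =
     (∑ j : Fin n, A 0 j.succ * (star x * y j)).re + (∑ j : Fin n, A j.succ 0 * (star (y j) * x)).re := by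
    rw [Finset.sum_mul, Complex.re_sum, Complex.re_sum, Complex.re_sum, ← Finset.sum_add_distrib]
    refine Finset.sum_congr rfl fun j _ => ?_
    simp only [Complex.star_def, Complex.mul_re, Complex.mul_im, Complex.add_re, Complex.add_im, Complex.conj_re, Complex.conj_im]
    ring
  simp only [Finset.sum_add_distrib, Complex.sub_re, Complex.add_re, h1, h2, Complex.re_mul_ofReal]
  ring

theorem supermart {δ C : ℝ} (S : Measure ℂ → Prop) (hS : ∀ μ, S μ → IsProbabilityMeasure μ)
    (hC : ∀ μ : Measure ℂ, S μ → ∀ (a : ℝ) (β : ℂ),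
    |a| ≤ δ / 4 → ∫⁻ z, ENNReal.ofReal (Real.exp (a * (‖z‖ ^ 2 - ∫ w, ‖w‖ ^ 2 ∂μ) + (β * z).re)) ∂μ
      ≤ ENNReal.ofReal (Real.exp (C * (a ^ 2 + ‖β‖ ^ 2)))) :
    ∀ (n : ℕ) (μ : Fin n → Measure ℂ), (∀ i, S (μ i)) → ∀ A : Fin n → Fin n → ℂ, (∀ i, |(A i i).re| ≤ δ / 4) →
    ∫⁻ z, ENNReal.ofReal (Real.exp ((Qc μ A z).re - C * Vf A z)) ∂Measure.pi μ ≤ 1 := by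
  intro n
  induction n with
  | zero =>
    intro μ hμ A hA
    simp [Qc, Vf]
  | succ n ih =>
    intro μ hμ A hA
    have := fun i => hS _ (hμ i)
    have hc1 := Qc_cont μ A
    have hc2 := Vf_cont A
    rw [lint_cons μ _ (by fun_prop)]
    refine le_trans (lintegral_mono fun y => ?_) (ih (fun j => μ j.succ) (fun i => hμ i.succ) (fun i j => A i.succ j.succ) fun i => hA _)
    set b := ∑ j : Fin n, (star (A 0 j.succ) + A j.succ 0) * star (y j) with hb
    have h0 := hC _ (hμ 0) (A 0 0).re b (hA 0)
    have : ∀ x : ℂ, ENNReal.ofReal (Real.exp ((Qc μ A (Fin.cons x y)).re - C * Vf A (Fin.cons x y))) =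
      ENNReal.ofReal (Real.exp ((A 0 0).re * (‖x‖ ^ 2 - ∫ w, ‖w‖ ^ 2 ∂μ 0) + (b * x).re)) *
       ENNReal.ofReal (Real.exp ((Qc (fun j => μ j.succ) (fun i j => A i.succ j.succ) y).re - C * Vf (fun i j => A i.succ j.succ) y
         - C * ((A 0 0).re ^ 2 + ‖b‖ ^ 2))) := by
      intro x
      rw [← ENNReal.ofReal_mul (Real.exp_pos _).le, ← Real.exp_add, Qc_cons, Vf_cons]
      congr 2
      ring
    simp_rw [this]
    rw [lintegral_mul_const _ (by fun_prop)]
    refine (mul_le_mul_left h0 _).trans ?_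
    rw [← ENNReal.ofReal_mul (Real.exp_pos _).le, ← Real.exp_add]
    apply ENNReal.ofReal_le_ofReal
    apply Real.exp_le_exp.2
    linarith

end Conc2

section Conc3

theorem lint_gauss {b : ℝ} (hb : 0 < b) : ∫⁻ g : ℝ, ENNReal.ofReal (Real.exp (-b * g ^ 2)) =
    ENNReal.ofReal (Real.sqrt (Real.pi / b)) := by
  rw [← integral_gaussian, ofReal_integral_eq_lintegral_ofReal (integrable_exp_neg_mul_sq hb)
    (ae_of_all _ fun _ => (Real.exp_pos _).le)]

theorem lint_gauss_shift {b : ℝ} (hb : 0 < b) (x : ℝ) : ∫⁻ g : ℝ, ENNReal.ofReal (Real.exp (g * x - b * g ^ 2)) =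
    ENNReal.ofReal (Real.exp (x ^ 2 / (4 * b))) * ENNReal.ofReal (Real.sqrt (Real.pi / b)) := by
  rw [← lint_gauss hb, ← lintegral_const_mul _ (by fun_prop),
    ← lintegral_sub_right_eq_self (fun g : ℝ => ENNReal.ofReal (Real.exp (x ^ 2 / (4 * b))) *
      ENNReal.ofReal (Real.exp (-b * g ^ 2))) (x / (2 * b))]
  refine lintegral_congr fun g => ?_
  rw [← ENNReal.ofReal_mul (Real.exp_pos _).le, ← Real.exp_add]
  congr 2
  field_simp; ring

theorem exp_sq {Ω : Type*} [MeasurableSpace Ω] {P : Measure Ω} [IsProbabilityMeasure P] {X : Ω → ℝ} (hX : Measurable X)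
    {c : ℝ} (hc : 0 < c) (h : ∀ g : ℝ, ∫⁻ ω, ENNReal.ofReal (Real.exp (g * X ω)) ∂P ≤ ENNReal.ofReal (Real.exp (c * g ^ 2))) :
    ∫⁻ ω, ENNReal.ofReal (Real.exp (X ω ^ 2 / (8 * c))) ∂P ≤ 2 := by
  set s := ENNReal.ofReal (Real.sqrt (Real.pi / (2 * c))) with hs
  have hs0 : s ≠ 0 := by
    rw [hs, Ne, ENNReal.ofReal_eq_zero, not_le]
    exact Real.sqrt_pos.2 (by positivity)
  have key : (∫⁻ ω, ENNReal.ofReal (Real.exp (X ω ^ 2 / (8 * c))) ∂P) * s ≤ 2 * s := by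
    rw [← lintegral_mul_const _ (by fun_prop)]
    calc _ = ∫⁻ ω, (∫⁻ g : ℝ, ENNReal.ofReal (Real.exp (g * X ω - (2 * c) * g ^ 2))) ∂P := by
          refine lintegral_congr fun ω => ?_
          rw [lint_gauss_shift (by positivity : 0 < 2 * c)]
          congr 4; ring
      _ = ∫⁻ g : ℝ, ∫⁻ ω, ENNReal.ofReal (Real.exp (g * X ω - (2 * c) * g ^ 2)) ∂P := by
          apply lintegral_lintegral_swap
          apply Measurable.aemeasurable
          unfold Function.uncurry
          fun_prop
      _ ≤ ∫⁻ g : ℝ, ENNReal.ofReal (Real.exp (-c * g ^ 2)) := by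
          refine lintegral_mono fun g => ?_
          have : ∀ ω, ENNReal.ofReal (Real.exp (g * X ω - (2 * c) * g ^ 2)) = ENNReal.ofReal (Real.exp (g * X ω)) *
            ENNReal.ofReal (Real.exp (- (2 * c) * g ^ 2)) := by
            intro ω
            rw [← ENNReal.ofReal_mul (Real.exp_pos _).le, ← Real.exp_add]
            congr 2; ring
          simp_rw [this]
          rw [lintegral_mul_const _ (by fun_prop)]
          refine (mul_le_mul_left (h g) _).trans ?_
          rw [← ENNReal.ofReal_mul (Real.exp_pos _).le, ← Real.exp_add]
          apply ENNReal.ofReal_le_ofReal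
          apply Real.exp_le_exp.2
          linarith
      _ = ENNReal.ofReal (Real.sqrt (Real.pi / c)) := lint_gauss hc
      _ ≤ 2 * s := by
          rw [hs, ← ENNReal.ofReal_ofNat, ← ENNReal.ofReal_mul (by norm_num)]
          apply ENNReal.ofReal_le_ofReal
          apply Real.sqrt_le_iff.2
          refine ⟨by positivity, ?_⟩
          rw [mul_pow, Real.sq_sqrt (by positivity)]
          have h1 : Real.pi / (2 * c) = (Real.pi / c) / 2 := by field_simp
          have : 0 < Real.pi / c := by positivity
          rw [h1]; linarith
  exact (ENNReal.mul_le_mul_iff_left hs0 ENNReal.ofReal_ne_top).1 key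

theorem exp_sq_lin {C : ℝ} (hC0 : 0 < C) {n : ℕ} {μ : Fin n → Measure ℂ} [∀ i, IsProbabilityMeasure (μ i)]
    (hC : ∀ β : Fin n → ℂ, ∫⁻ z, ENNReal.ofReal (Real.exp ((∑ i, β i * z i).re)) ∂Measure.pi μ
      ≤ ENNReal.ofReal (Real.exp (C * ∑ i, ‖β i‖ ^ 2))) (β : Fin n → ℂ) :
    ∫⁻ z, ENNReal.ofReal (Real.exp (‖∑ i, β i * star (z i)‖ ^ 2 / (16 * C * ∑ i, ‖β i‖ ^ 2))) ∂Measure.pi μ ≤ 2 := by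
  set s := ∑ i, ‖β i‖ ^ 2 with hs
  have hs0 : 0 ≤ s := Finset.sum_nonneg fun _ _ => by positivity
  rcases hs0.eq_or_lt with h0 | hpos
  · rw [← h0]; simp
  have hn : ∀ z : Fin n → ℂ, ‖∑ i, β i * star (z i)‖ = ‖∑ i, star (β i) * z i‖ := by
    intro z
    rw [← norm_star, star_sum]
    congr 1
    refine Finset.sum_congr rfl fun i _ => ?_
    simp
  have hr : ∫⁻ z, ENNReal.ofReal (Real.exp ((∑ i, star (β i) * z i).re ^ 2 / (8 * (C * s)))) ∂Measure.pi μ ≤ 2 := by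
    refine exp_sq (X := fun z : Fin n → ℂ => (∑ i, star (β i) * z i).re) (by fun_prop) (by positivity) fun g => ?_
    have := hC fun i => g * star (β i)
    simp only [mul_assoc, ← Finset.mul_sum, Complex.re_ofReal_mul] at this
    refine this.trans (le_of_eq ?_)
    congr 2
    rw [hs, mul_assoc, Finset.sum_mul]; congr 1
    refine Finset.sum_congr rfl fun i _ => ?_
    simp [mul_pow, mul_comm]
  have hi : ∫⁻ z, ENNReal.ofReal (Real.exp ((∑ i, star (β i) * z i).im ^ 2 / (8 * (C * s)))) ∂Measure.pi μ ≤ 2 := by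
    refine exp_sq (X := fun z : Fin n → ℂ => (∑ i, star (β i) * z i).im) (by fun_prop) (by positivity) fun g => ?_
    have := hC fun i => ((g : ℝ) : ℂ) * (-Complex.I * star (β i))
    simp only [mul_assoc, ← Finset.mul_sum, Complex.re_ofReal_mul] at this
    have e : ∀ w : ℂ, (-Complex.I * w).re = w.im := by intro w; simp
    simp only [e] at this
    refine this.trans (le_of_eq ?_)
    congr 2
    rw [hs, mul_assoc, Finset.sum_mul]; congr 1
    refine Finset.sum_congr rfl fun i _ => ?_
    simp [mul_pow, mul_comm]
  calc _ ≤ ∫⁻ z, (2⁻¹ * ENNReal.ofReal (Real.exp ((∑ i, star (β i) * z i).re ^ 2 / (8 * (C * s)))) +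
        2⁻¹ * ENNReal.ofReal (Real.exp ((∑ i, star (β i) * z i).im ^ 2 / (8 * (C * s))))) ∂Measure.pi μ := by
        refine lintegral_mono fun z => ?_
        have e2 : (2⁻¹ : ℝ≥0∞) = ENNReal.ofReal (2⁻¹) := by
          rw [ENNReal.ofReal_inv_of_pos (by norm_num)]; norm_num
        rw [e2, ← ENNReal.ofReal_mul (by norm_num), ← ENNReal.ofReal_mul (by norm_num), ← ENNReal.ofReal_add (by positivity) (by positivity)]
        apply ENNReal.ofReal_le_ofReal
        rw [hn, ← Complex.normSq_eq_norm_sq, Complex.normSq_apply]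
        set w := ∑ i, star (β i) * z i
        set p := w.re ^ 2 / (8 * (C * s))
        set q := w.im ^ 2 / (8 * (C * s))
        have : (w.re * w.re + w.im * w.im) / (16 * C * s) = p / 2 + q / 2 := by
          simp only [p, q]; field_simp; ring
        rw [this, Real.exp_add]
        have hp : Real.exp p = Real.exp (p / 2) ^ 2 := by rw [← Real.exp_nat_mul]; congr 1; push_cast; ring
        have hq : Real.exp q = Real.exp (q / 2) ^ 2 := by rw [← Real.exp_nat_mul]; congr 1; push_cast; ring
        rw [hp, hq]
        nlinarith [sq_nonneg (Real.exp (p / 2) - Real.exp (q / 2))]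
    _ ≤ 2⁻¹ * 2 + 2⁻¹ * 2 := by
        rw [lintegral_add_left (by fun_prop), lintegral_const_mul _ (by fun_prop), lintegral_const_mul _ (by fun_prop)]
        gcongr
    _ = 2 := by rw [ENNReal.inv_mul_cancel (by norm_num) (by norm_num)]; norm_num

theorem rowb_sum {n : ℕ} (A : Fin n → Fin n → ℂ) :
    ∑ i, ∑ j, ‖rowb A i j‖ ^ 2 ≤ 4 * ∑ i, ∑ j, ‖A i j‖ ^ 2 := by
  have : ∀ i j, ‖rowb A i j‖ ^ 2 ≤ 2 * ‖A i j‖ ^ 2 + 2 * ‖A j i‖ ^ 2 := by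
    intro i j
    unfold rowb
    split_ifs
    · have h1 := norm_add_le (star (A i j)) (A j i)
      rw [norm_star] at h1
      nlinarith [sq_nonneg (‖A i j‖ - ‖A j i‖), norm_nonneg (A i j), norm_nonneg (A j i), norm_nonneg (star (A i j) + A j i)]
    · simp; positivity
  refine (Finset.sum_le_sum fun i _ => Finset.sum_le_sum fun j _ => this i j).trans (le_of_eq ?_)
  simp_rw [Finset.sum_add_distrib, ← Finset.mul_sum]
  rw [Finset.sum_comm (f := fun i j => ‖A j i‖ ^ 2)]
  ring

theorem exp_V {C : ℝ} (hC1 : 1 ≤ C) {n : ℕ} {μ : Fin n → Measure ℂ} [∀ i, IsProbabilityMeasure (μ i)]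
    (hC : ∀ β : Fin n → ℂ, ∫⁻ z, ENNReal.ofReal (Real.exp ((∑ i, β i * z i).re)) ∂Measure.pi μ
      ≤ ENNReal.ofReal (Real.exp (C * ∑ i, ‖β i‖ ^ 2))) (A : Fin n → Fin n → ℂ)
    (hF : 64 * C ^ 2 * ∑ i, ∑ j, ‖A i j‖ ^ 2 ≤ 1) :
    ∫⁻ z, ENNReal.ofReal (Real.exp (C * Vf A z)) ∂Measure.pi μ ≤ 6 := by
  set F := ∑ i, ∑ j, ‖A i j‖ ^ 2 with hFd
  have hF0 : 0 ≤ F := by positivity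
  have hCF : C * F ≤ 1 := by nlinarith [mul_nonneg (by linarith : 0 ≤ C) hF0]
  set s : Fin n → ℝ := fun i => ∑ j, ‖rowb A i j‖ ^ 2 with hs
  set S := ∑ i, s i with hS
  have hs0 : ∀ i, 0 ≤ s i := fun i => by simp only [hs]; positivity
  have hSF : S ≤ 4 * F := rowb_sum A
  have hL0 : ∀ i, s i = 0 → ∀ z, Lf A i z = 0 := by
    intro i hi z
    simp only [hs] at hi
    rw [Finset.sum_eq_zero_iff_of_nonneg fun _ _ => by positivity] at hi
    unfold Lf
    refine Finset.sum_eq_zero fun j hj => ?_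
    have := hi j hj
    simp at this
    simp [this]
  have hdiag : ∑ i, (A i i).re ^ 2 ≤ F := by
    refine Finset.sum_le_sum fun i _ => ?_
    refine le_trans ?_ (Finset.single_le_sum (f := fun j => ‖A i j‖ ^ 2) (fun _ _ => by positivity) (Finset.mem_univ i))
    rw [← sq_abs]
    exact pow_le_pow_left₀ (abs_nonneg _) (Complex.abs_re_le_norm _) 2
  have he : Real.exp 1 ≤ 3 := by linarith [Real.exp_one_lt_d9]
  have hVf : ∀ z, C * Vf A z ≤ 1 + C * ∑ i, ‖Lf A i z‖ ^ 2 := by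
    intro z
    unfold Vf
    rw [Finset.sum_add_distrib]
    nlinarith
  have hS0 : 0 ≤ S := Finset.sum_nonneg fun i _ => hs0 i
  rcases hS0.eq_or_lt with hz | hpos
  · have hsz : ∀ i, s i = 0 := fun i => (Finset.sum_eq_zero_iff_of_nonneg fun i _ => hs0 i).1 hz.symm i (Finset.mem_univ i)
    calc _ ≤ ∫⁻ z, ENNReal.ofReal 6 ∂Measure.pi μ := by
          refine lintegral_mono fun z => ENNReal.ofReal_le_ofReal ?_
          have := hVf z
          simp only [hL0 _ (hsz _) z] at this
          have h2 := Real.exp_le_exp.2 this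
          simp only [norm_zero] at h2
          norm_num at h2
          have h3 := Real.exp_le_exp.2 h2
          linarith
      _ = 6 := by simp
  · calc _ ≤ ∫⁻ z, ∑ i, ENNReal.ofReal (3 * (s i / S)) * ENNReal.ofReal (Real.exp (‖Lf A i z‖ ^ 2 / (16 * C * s i))) ∂Measure.pi μ := by
          refine lintegral_mono fun z => ?_
          simp_rw [← ENNReal.ofReal_mul (mul_nonneg (by norm_num : (0:ℝ) ≤ 3) (div_nonneg (hs0 _) hS0))]
          rw [← ENNReal.ofReal_sum_of_nonneg fun i _ => mul_nonneg (mul_nonneg (by norm_num : (0:ℝ) ≤ 3) (div_nonneg (hs0 _) hS0)) (Real.exp_pos _).le]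
          apply ENNReal.ofReal_le_ofReal
          have j := convexOn_exp.map_sum_le (t := Finset.univ) (w := fun i => s i / S) (p := fun i => C * S * ‖Lf A i z‖ ^ 2 / s i)
            (fun i _ => div_nonneg (hs0 _) hS0) (by rw [← Finset.sum_div]; exact div_self hpos.ne') (fun _ _ => trivial)
          simp only [smul_eq_mul] at j
          have e1 : ∑ i, (s i / S * (C * S * ‖Lf A i z‖ ^ 2 / s i)) = C * ∑ i, ‖Lf A i z‖ ^ 2 := by
            rw [Finset.mul_sum Finset.univ (fun i => ‖Lf A i z‖ ^ 2) C]
            refine Finset.sum_congr rfl fun i _ => ?_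
            by_cases hi : s i = 0
            · simp [hi, hL0 i hi]
            · field_simp
          rw [e1] at j
          calc Real.exp (C * Vf A z) ≤ Real.exp (1 + C * ∑ i, ‖Lf A i z‖ ^ 2) := Real.exp_le_exp.2 (hVf z)
            _ = Real.exp 1 * Real.exp (C * ∑ i, ‖Lf A i z‖ ^ 2) := Real.exp_add _ _
            _ ≤ 3 * ∑ i, s i / S * Real.exp (C * S * ‖Lf A i z‖ ^ 2 / s i) := by gcongr
            _ ≤ 3 * ∑ i, s i / S * Real.exp (‖Lf A i z‖ ^ 2 / (16 * C * s i)) := by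
                have : ∀ i, C * S * ‖Lf A i z‖ ^ 2 / s i ≤ ‖Lf A i z‖ ^ 2 / (16 * C * s i) := by
                  intro i
                  by_cases hi : s i = 0
                  · simp [hi]
                  have hi' : 0 < s i := lt_of_le_of_ne (hs0 i) (Ne.symm hi)
                  have hC0 : 0 < C := by linarith
                  rw [div_le_div_iff₀ hi' (by positivity)]
                  have : C * S * (16 * C) ≤ 1 := by nlinarith
                  have h3 : 0 ≤ ‖Lf A i z‖ ^ 2 * s i := by positivity
                  nlinarith
                refine mul_le_mul_of_nonneg_left (Finset.sum_le_sum fun i _ =>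
                  mul_le_mul_of_nonneg_left (Real.exp_le_exp.2 (this i)) (div_nonneg (hs0 i) hS0)) (by norm_num)
            _ = _ := by rw [Finset.mul_sum]; refine Finset.sum_congr rfl fun i _ => ?_; ring
      _ = ∑ i, ENNReal.ofReal (3 * (s i / S)) * ∫⁻ z, ENNReal.ofReal (Real.exp (‖Lf A i z‖ ^ 2 / (16 * C * s i))) ∂Measure.pi μ := by
          have hc := Lf_cont A
          rw [lintegral_finsetSum _ fun i _ => by fun_prop]
          refine Finset.sum_congr rfl fun i _ => ?_
          rw [lintegral_const_mul _ (by fun_prop)]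
      _ ≤ ∑ i, ENNReal.ofReal (3 * (s i / S)) * 2 := by
          gcongr with i _
          exact exp_sq_lin (by linarith) hC _
      _ = 6 := by
          rw [← Finset.sum_mul, ← ENNReal.ofReal_sum_of_nonneg fun i _ => mul_nonneg (by norm_num : (0:ℝ) ≤ 3) (div_nonneg (hs0 _) hS0),
            ← Finset.mul_sum, ← Finset.sum_div, ← hS, div_self hpos.ne']
          norm_num

end Conc3

section Conc4

theorem Qc_smul {n : ℕ} (μ : Fin n → Measure ℂ) (A : Fin n → Fin n → ℂ) (t : ℂ) (z : Fin n → ℂ) :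
    Qc μ (fun i j => t * A i j) z = t * Qc μ A z := by
  unfold Qc
  simp only [mul_assoc, ← Finset.mul_sum, mul_sub]

theorem re_tail {C : ℝ} {n : ℕ} {μ : Fin n → Measure ℂ} [∀ i, IsProbabilityMeasure (μ i)] (A : Fin n → Fin n → ℂ)
    (h1 : ∫⁻ z, ENNReal.ofReal (Real.exp ((Qc μ A z).re - C * Vf A z)) ∂Measure.pi μ ≤ 1)
    (h2 : ∫⁻ z, ENNReal.ofReal (Real.exp (C * Vf A z)) ∂Measure.pi μ ≤ 6) (s : ℝ) :
    Measure.pi μ {z | s ≤ (Qc μ A z).re} ≤ ENNReal.ofReal (4 * Real.exp (-(s / 2))) := by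
  have hc1 := Qc_cont μ A
  have hc2 := Vf_cont A
  have e2 : (2⁻¹ : ℝ≥0∞) = ENNReal.ofReal (2⁻¹) := by
    rw [ENNReal.ofReal_inv_of_pos (by norm_num)]; norm_num
  have h3 : ∫⁻ z, ENNReal.ofReal (Real.exp ((Qc μ A z).re / 2)) ∂Measure.pi μ ≤ ENNReal.ofReal 4 := by
    calc _ ≤ ∫⁻ z, (2⁻¹ * ENNReal.ofReal (Real.exp ((Qc μ A z).re - C * Vf A z)) +
          2⁻¹ * ENNReal.ofReal (Real.exp (C * Vf A z))) ∂Measure.pi μ := by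
          refine lintegral_mono fun z => ?_
          rw [e2, ← ENNReal.ofReal_mul (by norm_num), ← ENNReal.ofReal_mul (by norm_num), ← ENNReal.ofReal_add (by positivity) (by positivity)]
          apply ENNReal.ofReal_le_ofReal
          set p := (Qc μ A z).re - C * Vf A z with hp'
          set q := C * Vf A z
          have : (Qc μ A z).re / 2 = p / 2 + q / 2 := by rw [hp']; ring
          rw [this, Real.exp_add]
          have hp : Real.exp p = Real.exp (p / 2) ^ 2 := by rw [← Real.exp_nat_mul]; congr 1; push_cast; ring
          have hq : Real.exp q = Real.exp (q / 2) ^ 2 := by rw [← Real.exp_nat_mul]; congr 1; push_cast; ring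
          rw [hp, hq]
          nlinarith [sq_nonneg (Real.exp (p / 2) - Real.exp (q / 2))]
      _ ≤ 2⁻¹ * 1 + 2⁻¹ * 6 := by
          rw [lintegral_add_left (by fun_prop), lintegral_const_mul _ (by fun_prop), lintegral_const_mul _ (by fun_prop)]
          gcongr
      _ ≤ ENNReal.ofReal 4 := by
          rw [e2, show (6 : ℝ≥0∞) = ENNReal.ofReal 6 by simp, mul_one, ← ENNReal.ofReal_mul (by norm_num), ← ENNReal.ofReal_add (by norm_num) (by norm_num)]
          apply ENNReal.ofReal_le_ofReal; norm_num
  have h4 := meas_ge_le_lintegral_div (μ := Measure.pi μ) (f := fun z => ENNReal.ofReal (Real.exp ((Qc μ A z).re / 2)))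
    (by fun_prop) (ε := ENNReal.ofReal (Real.exp (s / 2))) (by simp [Real.exp_pos]) ENNReal.ofReal_ne_top
  refine le_trans (measure_mono fun z hz => ?_) (h4.trans ?_)
  · simp only [Set.mem_ofPred_eq] at hz ⊢
    apply ENNReal.ofReal_le_ofReal
    apply Real.exp_le_exp.2; linarith
  · refine (ENNReal.div_le_div_right h3 _).trans (le_of_eq ?_)
    rw [← ENNReal.ofReal_div_of_pos (Real.exp_pos _), Real.exp_neg, div_eq_mul_inv]

theorem quad_tail (δ D : ℝ) (hδ : 0 < δ) : ∃ c : ℝ, 0 < c ∧ ∀ (n : ℕ) (μ : Fin n → Measure ℂ), (∀ i, SG δ D (μ i)) →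
    ∀ (A : Fin n → Fin n → ℂ) (u Fb : ℝ), 0 < Fb → ∑ i, ∑ j, ‖A i j‖ ^ 2 ≤ Fb →
    Measure.pi μ {z | u ≤ ‖Qc μ A z‖} ≤ ENNReal.ofReal (16 * Real.exp (-(c * u / Real.sqrt Fb))) := by
  obtain ⟨C, hC1, hC⟩ := mgf_one δ D hδ
  have hS : ∀ μ, SG δ D μ → IsProbabilityMeasure μ := fun μ h => h.1
  set f0 := min (1 / (64 * C ^ 2)) (δ ^ 2 / 16) with hf0
  have hf0p : 0 < f0 := by
    apply lt_min <;> positivity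
  refine ⟨Real.sqrt f0 / 4, by positivity, ?_⟩
  intro n μ hμ A u Fb hFb hF
  have := fun i => (hμ i).1
  have hre : ∀ A : Fin n → Fin n → ℂ, ∑ i, ∑ j, ‖A i j‖ ^ 2 ≤ f0 → ∀ s,
      Measure.pi μ {z | s ≤ (Qc μ A z).re} ≤ ENNReal.ofReal (4 * Real.exp (-(s / 2))) := by
    intro A hA s
    apply re_tail (C := C) A
    · apply supermart (δ := δ) _ hS hC n μ hμ
      intro i
      have h1 : (A i i).re ^ 2 ≤ (δ / 4) ^ 2 := by
        calc (A i i).re ^ 2 ≤ ‖A i i‖ ^ 2 := by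
              rw [← sq_abs]; exact pow_le_pow_left₀ (abs_nonneg _) (Complex.abs_re_le_norm _) 2
          _ ≤ ∑ j, ‖A i j‖ ^ 2 := Finset.single_le_sum (f := fun j => ‖A i j‖ ^ 2) (fun _ _ => by positivity) (Finset.mem_univ i)
          _ ≤ ∑ i, ∑ j, ‖A i j‖ ^ 2 := Finset.single_le_sum (f := fun i => ∑ j, ‖A i j‖ ^ 2) (fun _ _ => by positivity) (Finset.mem_univ i)
          _ ≤ f0 := hA
          _ ≤ δ ^ 2 / 16 := min_le_right _ _
          _ = _ := by ring
      exact abs_le_of_sq_le_sq h1 (by positivity)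
    · apply exp_V hC1 (lin_mgf hδ _ hS hC n μ hμ)
      have : ∑ i, ∑ j, ‖A i j‖ ^ 2 ≤ 1 / (64 * C ^ 2) := hA.trans (min_le_left _ _)
      rw [le_div_iff₀ (by positivity)] at this
      linarith
  set t := Real.sqrt (f0 / Fb) with ht
  have htp : 0 < t := Real.sqrt_pos.2 (by positivity)
  have htF : ∀ w : ℂ, ‖w‖ = 1 → ∑ i, ∑ j, ‖(w * t) * A i j‖ ^ 2 ≤ f0 := by
    intro w hw
    have : ∀ i j, ‖(w * t) * A i j‖ ^ 2 = t ^ 2 * ‖A i j‖ ^ 2 := by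
      intro i j; simp [hw, mul_pow]
    simp_rw [this, ← Finset.mul_sum]
    rw [ht, Real.sq_sqrt (by positivity)]
    calc _ ≤ f0 / Fb * Fb := by gcongr
      _ = f0 := by field_simp
  have hw : ∀ w : ℂ, ‖w‖ = 1 → Measure.pi μ {z | t * u / 2 ≤ ((w * t) * Qc μ A z).re} ≤
      ENNReal.ofReal (4 * Real.exp (-(t * u / 4))) := by
    intro w hw
    have := hre _ (htF w hw) (t * u / 2)
    simp_rw [Qc_smul] at this
    convert this using 4
    ring
  have hsub : {z | u ≤ ‖Qc μ A z‖} ⊆ ({z | t * u / 2 ≤ ((1 * t) * Qc μ A z).re} ∪ {z | t * u / 2 ≤ ((-1 * t) * Qc μ A z).re}) ∪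
      ({z | t * u / 2 ≤ ((Complex.I * t) * Qc μ A z).re} ∪ {z | t * u / 2 ≤ ((-Complex.I * t) * Qc μ A z).re}) := by
    intro z hz
    simp only [Set.mem_ofPred_eq] at hz
    have hq := Complex.norm_le_abs_re_add_abs_im (Qc μ A z)
    simp only [Set.mem_union, Set.mem_ofPred_eq]
    generalize Qc μ A z = q at hz hq ⊢
    have e1 : ((1 * (t : ℂ)) * q).re = t * q.re := by simp
    have e2 : ((-1 * (t : ℂ)) * q).re = t * (-q.re) := by simp
    have e3 : ((Complex.I * (t : ℂ)) * q).re = t * (-q.im) := by simp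
    have e4 : ((-Complex.I * (t : ℂ)) * q).re = t * q.im := by simp
    rw [e1, e2, e3, e4]
    simp only [mul_div_assoc, mul_le_mul_iff_right₀ htp]
    by_contra hcon
    push Not at hcon
    obtain ⟨⟨a1, a2⟩, a3, a4⟩ := hcon
    have b1 : |q.re| < u / 2 := abs_lt.2 ⟨by linarith, a1⟩
    have b2 : |q.im| < u / 2 := abs_lt.2 ⟨by linarith, a4⟩
    linarith
  refine (measure_mono hsub).trans ((measure_union_le _ _).trans
    ((add_le_add (measure_union_le _ _) (measure_union_le _ _)).trans
    ((add_le_add (add_le_add (hw 1 (by simp)) (hw (-1) (by simp))) (add_le_add (hw Complex.I (by simp)) (hw (-Complex.I) (by simp)))).trans ?_)))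
  rw [← ENNReal.ofReal_add (by positivity) (by positivity), ← ENNReal.ofReal_add (by positivity) (by positivity)]
  apply ENNReal.ofReal_le_ofReal
  have : t * u / 4 = Real.sqrt f0 / 4 * u / Real.sqrt Fb := by
    rw [ht, Real.sqrt_div hf0p.le]; ring
  rw [this]
  linarith

end Conc4

section PB

/-- zeroed resolvent of the minor -/
def zres {N : ℕ} (k : Fin N) (E η : ℝ) (R : Fin N → Fin N → ℂ) (i j : Fin N) : ℂ :=
  if i = k ∨ j = k then 0 else res (Matrix.of R) E η i j

/-- regularized trace as a function of the minor -/
def ztp {N : ℕ} (k : Fin N) (E η : ℝ) (R : Fin N → Fin N → ℂ) : ℝ :=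
  (∑ i, zres k E η R i i).im / N + η

theorem zres_meas {N : ℕ} (k : Fin N) (E η : ℝ) (i j : Fin N) : Measurable (fun R => zres k E η R i j) := by
  unfold zres
  split_ifs
  · exact measurable_const
  · have hc : Continuous (fun R : Fin N → Fin N → ℂ => (Matrix.of R : Matrix (Fin N) (Fin N) ℂ) -
        ((E : ℂ) + η * Complex.I) • (1 : Matrix (Fin N) (Fin N) ℂ)) := by
      refine Continuous.sub ?_ continuous_const
      exact continuous_id
    have h1 := hc.matrix_det.measurable
    have h2 := (hc.matrix_adjugate.matrix_elem i j).measurable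
    unfold res
    simp only [Matrix.inv_def, Matrix.smul_apply, Ring.inverse_eq_inv', smul_eq_mul]
    exact h1.inv.mul h2

theorem ztp_meas {N : ℕ} (k : Fin N) (E η : ℝ) : Measurable (ztp k E η : (Fin N → Fin N → ℂ) → ℝ) := by
  have := zres_meas k E η
  unfold ztp
  refine Measurable.add_const (Measurable.div_const (Complex.measurable_im.comp ?_) _) _
  exact Finset.measurable_fun_sum _ fun i _ => this i i

theorem zsum_ptr {N : ℕ} (k : Fin N) (E η : ℝ) (H : Matrix (Fin N) (Fin N) ℂ) :
    ∑ i, zres k E η (minor k H) i i = ptr k H E η := by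
  unfold ptr
  rw [← Finset.add_sum_erase _ _ (Finset.mem_univ k)]
  simp only [zres, true_or, if_true, zero_add]
  refine Finset.sum_congr rfl fun j hj => ?_
  rw [if_neg (by simpa using hj)]
  rfl

theorem ztp_eq {N : ℕ} (k : Fin N) (E η : ℝ) (H : Matrix (Fin N) (Fin N) ℂ) :
    ztp k E η (minor k H) = Tp k H E η := by
  unfold ztp Tp
  rw [zsum_ptr]; simp

theorem zF {N : ℕ} (hN : 0 < N) (k : Fin N) (E : ℝ) {η : ℝ} (hη : 0 < η) {H : Matrix (Fin N) (Fin N) ℂ} (hH : H.IsHermitian) :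
    ∑ i, ∑ j, ‖zres k E η (minor k H) i j‖ ^ 2 ≤ N * ztp k E η (minor k H) / η := by
  have h := ptr_im hH k E hη
  have h2 : ∑ i, ∑ j, ‖zres k E η (minor k H) i j‖ ^ 2 =
    ∑ i, ∑ j, ‖if i = k ∨ j = k then (0 : ℂ) else res (minor k H) E η i j‖ ^ 2 := rfl
  rw [h2, le_div_iff₀ hη, mul_comm, ← h, ztp_eq, Tp]
  have hN' : (0 : ℝ) < N := by exact_mod_cast hN
  simp only [Fintype.card_fin]
  field_simp
  nlinarith

theorem quad_zres {N : ℕ} (hN : 0 < N) (k : Fin N) (E η : ℝ) (H : Matrix (Fin N) (Fin N) ℂ) (μ : Fin N → Measure ℂ)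
    (hμ : ∀ j, j ≠ k → (∫ w, ‖w‖ ^ 2 ∂μ j) = 1) :
    star (colv k H) ⬝ᵥ res (minor k H) E η *ᵥ colv k H - ptr k H E η / (N : ℂ) =
      Qc μ (zres k E η (minor k H)) (fun j => (Real.sqrt N : ℂ) * H j k) / N := by
  have hN' : (N : ℂ) ≠ 0 := by exact_mod_cast hN.ne'
  have h1 : ∑ i, zres k E η (minor k H) i i * ((∫ w, ‖w‖ ^ 2 ∂μ i : ℝ) : ℂ) = ptr k H E η := by
    rw [← zsum_ptr]
    refine Finset.sum_congr rfl fun i _ => ?_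
    by_cases hi : i = k
    · simp [zres, hi]
    · rw [hμ i hi]; simp
  have hs : (Real.sqrt N : ℂ) * (Real.sqrt N : ℂ) = N := by
    rw [← Complex.ofReal_mul, Real.mul_self_sqrt (Nat.cast_nonneg _)]; simp
  have h2 : ∑ i, ∑ j, zres k E η (minor k H) i j * (star ((Real.sqrt N : ℂ) * H i k) * ((Real.sqrt N : ℂ) * H j k)) =
      N * (star (colv k H) ⬝ᵥ res (minor k H) E η *ᵥ colv k H) := by
    simp only [dotProduct, mulVec, Finset.mul_sum]
    refine Finset.sum_congr rfl fun i _ => Finset.sum_congr rfl fun j _ => ?_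
    by_cases hi : i = k
    · simp [zres, colv, hi]
    by_cases hj : j = k
    · simp [zres, colv, hj]
    have : zres k E η (minor k H) i j = res (minor k H) E η i j := by
      unfold zres; rw [if_neg (by tauto)]; rfl
    rw [this]
    simp only [colv, hi, hj, if_false, Pi.star_apply, star_mul', Complex.star_def, Complex.conj_ofReal]
    linear_combination (res (minor k H) E η i j * (starRingEnd ℂ) (H i k) * H j k) * hs
  unfold Qc
  rw [h1, h2]
  field_simp

theorem SG_mono {δ D D2 : ℝ} {μ : Measure ℂ} (h : SG δ D μ) (hD : D ≤ D2) : SG δ D2 μ :=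
  ⟨h.1, h.2.1, h.2.2.trans (ENNReal.ofReal_le_ofReal hD)⟩

theorem SG_star {δ D : ℝ} {μ : Measure ℂ} (h : SG δ D μ) : SG δ D (μ.map star) := by
  have hm : Measurable (star : ℂ → ℂ) := continuous_star.measurable
  have := h.1
  refine ⟨Measure.isProbabilityMeasure_map hm.aemeasurable, ?_, ?_⟩
  · rw [integral_map hm.aemeasurable (by apply Continuous.aestronglyMeasurable; fun_prop)]
    have := integral_conj (μ := μ) (f := fun z : ℂ => z)
    simp only [Complex.star_def]
    rw [this, h.2.1]; simp
  · rw [lintegral_map (by fun_prop) hm]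
    simpa using h.2.2

theorem SG_real {δ D : ℝ} {μ : Measure ℝ} [IsProbabilityMeasure μ] (h0 : ∫ x, x ∂μ = 0)
    (h : (∫⁻ x, ENNReal.ofReal (Real.exp (δ * x ^ 2)) ∂μ) ≤ ENNReal.ofReal D) :
    SG δ D (μ.map (fun x : ℝ => (x : ℂ))) := by
  have hm : Measurable (fun x : ℝ => (x : ℂ)) := Complex.measurable_ofReal
  refine ⟨Measure.isProbabilityMeasure_map hm.aemeasurable, ?_, ?_⟩
  · rw [integral_map hm.aemeasurable (by apply Continuous.aestronglyMeasurable; fun_prop)]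
    have := integral_ofReal (μ := μ) (𝕜 := ℂ) (f := fun x : ℝ => x)
    simp only [h0] at this
    simpa using this
  · rw [lintegral_map (by fun_prop) hm]
    simpa using h

end PB

section PB2

variable {Ω : Type} [MeasurableSpace Ω] {P : Measure Ω} {N : ℕ} {H : Ω → Matrix (Fin N) (Fin N) ℂ}
  {ν : Measure ℂ} {ν' : Measure ℝ}

theorem wig_diag_eq (hW : IsWignerMatrix P N H ν ν') (i : Fin N) (ω : Ω) :
    H ω i i = (((H ω i i).re : ℝ) : ℂ) := by
  apply Complex.ext
  · simp
  · simp [hW.diag_real]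

theorem wig_star (hW : IsWignerMatrix P N H ν ν') (i j : Fin N) (ω : Ω) : H ω i j = star (H ω j i) := by
  have := hW.herm ω
  exact (this.apply i j).symm

theorem wig_ae (hN : 0 < N) (hW : IsWignerMatrix P N H ν ν') (i j : Fin N) : AEMeasurable (fun ω => H ω i j) P := by
  have hs : (Real.sqrt N : ℂ) ≠ 0 := by
    rw [Ne, Complex.ofReal_eq_zero]
    exact (Real.sqrt_pos.2 (by exact_mod_cast hN)).ne'
  have := hW.probν
  have := hW.probν'
  have key : ∀ i j : Fin N, i < j → AEMeasurable (fun ω => H ω i j) P := by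
    intro i j hij
    have h1 : AEMeasurable (fun ω => (Real.sqrt N : ℂ) * H ω i j) P :=
      aemeasurable_of_map_neZero (by rw [hW.offdiag i j hij]; infer_instance)
    have h2 := h1.const_mul (Real.sqrt N : ℂ)⁻¹
    refine h2.congr (ae_of_all _ fun ω => ?_)
    simp only
    field_simp
  rcases lt_trichotomy i j with h | h | h
  · exact key i j h
  · subst h
    have h1 : AEMeasurable (fun ω => Real.sqrt N * (H ω i i).re) P :=
      aemeasurable_of_map_neZero (by rw [hW.diag i]; infer_instance)
    have h2 := (Complex.measurable_ofReal.comp_aemeasurable h1).const_mul (Real.sqrt N : ℂ)⁻¹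
    refine h2.congr (ae_of_all _ fun ω => ?_)
    simp only [Function.comp]
    rw [wig_diag_eq hW i ω]
    push_cast
    simp only [Complex.ofReal_re]
    field_simp
  · have h1 := (continuous_star.measurable (α := ℂ)).comp_aemeasurable (key j i h)
    refine h1.congr (ae_of_all _ fun ω => ?_)
    simp only [Function.comp]
    rw [← wig_star hW]

/-- marginals of the scaled column -/
def cmu (P : Measure Ω) (H : Ω → Matrix (Fin N) (Fin N) ℂ) (k j : Fin N) : Measure ℂ :=
  P.map (fun ω => (Real.sqrt N : ℂ) * H ω j k)

theorem cmu_SG {δ₀ D D' : ℝ} (hN : 0 < N) (hW : IsWignerMatrix P N H ν ν') (hC : CondC1 ν ν' δ₀ D D') (k j : Fin N) :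
    SG δ₀ (max D D') (cmu P H k j) ∧ (j ≠ k → ∫ w, ‖w‖ ^ 2 ∂cmu P H k j = 1) := by
  have hp := hW.probν
  have hp' := hW.probν'
  have hν : SG δ₀ D ν := ⟨hW.probν, hW.mean, hC.2.1⟩
  rcases lt_trichotomy j k with h | h | h
  · have : cmu P H k j = ν := hW.offdiag j k h
    rw [this]
    exact ⟨SG_mono hν (le_max_left _ _), fun _ => hW.var⟩
  · subst h
    have : cmu P H j j = ν'.map (fun x : ℝ => (x : ℂ)) := by
      have hae : AEMeasurable (fun ω => Real.sqrt N * (H ω j j).re) P :=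
        (Complex.measurable_re.comp_aemeasurable (wig_ae hN hW j j)).const_mul _
      rw [← hW.diag j, AEMeasurable.map_map_of_aemeasurable Complex.measurable_ofReal.aemeasurable hae]
      unfold cmu
      congr 1
      ext ω
      rw [wig_diag_eq hW j ω]
      simp
    rw [this]
    exact ⟨SG_mono (SG_real hW.mean' hC.2.2) (le_max_right _ _), fun hh => absurd rfl hh⟩
  · have hm : Measurable (star : ℂ → ℂ) := continuous_star.measurable
    have : cmu P H k j = ν.map star := by
      rw [← hW.offdiag k j h, AEMeasurable.map_map_of_aemeasurable hm.aemeasurable ((wig_ae hN hW k j).const_mul _)]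
      unfold cmu
      congr 1
      ext ω
      rw [wig_star hW]
      simp
    rw [this]
    refine ⟨SG_mono (SG_star hν) (le_max_left _ _), fun _ => ?_⟩
    rw [integral_map hm.aemeasurable (by apply Continuous.aestronglyMeasurable; fun_prop)]
    simpa using hW.var

theorem col_pi (hN : 0 < N) (hW : IsWignerMatrix P N H ν ν') (k : Fin N) :
    P.map (fun ω j => (Real.sqrt N : ℂ) * H ω j k) = Measure.pi (cmu P H k) := by
  have := hW.prob
  have hi : iIndepFun (fun (j : Fin N) ω => (Real.sqrt N : ℂ) * H ω j k) P := by
    let e : Fin N → {p : Fin N × Fin N // p.1 ≤ p.2} := fun j => ⟨(min j k, max j k), min_le_max⟩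
    have he : Function.Injective e := by
      intro a b hab
      simp only [e, Subtype.mk.injEq, Prod.mk.injEq] at hab
      obtain ⟨h1, h2⟩ := hab
      rcases le_total a k with ha | ha <;> rcases le_total b k with hb | hb <;> simp_all <;>
        exact le_antisymm (by assumption) (by assumption)
    have h1 := hW.indep.precomp he
    have h2 := h1.comp (fun j (x : ℂ) => if j ≤ k then (Real.sqrt N : ℂ) * x else (Real.sqrt N : ℂ) * star x) (by
      intro j
      split_ifs
      · fun_prop
      · exact (continuous_star.measurable (α := ℂ)).const_mul _)
    convert h2 using 1
    ext j ω
    simp only [Function.comp, e]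
    split_ifs with h
    · rw [min_eq_left h, max_eq_right h]
    · rw [min_eq_right (le_of_not_ge h), max_eq_left (le_of_not_ge h), ← wig_star hW]
  exact (iIndepFun_iff_map_fun_eq_pi_map fun j => (wig_ae hN hW j k).const_mul _).1 hi

theorem col_indep (hN : 0 < N) (hW : IsWignerMatrix P N H ν ν') (k : Fin N) :
    IndepFun (fun ω (j : Fin N) => (Real.sqrt N : ℂ) * H ω j k) (fun ω => (fun i j => minor k (H ω) i j : Fin N → Fin N → ℂ)) P := by
  classical
  set S : Finset {p : Fin N × Fin N // p.1 ≤ p.2} := Finset.univ.filter fun p => p.1.1 = k ∨ p.1.2 = k with hS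
  set T : Finset {p : Fin N × Fin N // p.1 ≤ p.2} := Finset.univ.filter fun p => ¬ (p.1.1 = k ∨ p.1.2 = k) with hT
  have hd : Disjoint S T := Finset.disjoint_filter_filter_not _ _ _
  have h := hW.indep.indepFun_finset₀ S T hd (fun p => wig_ae hN hW _ _)
  have hst := continuous_star.measurable (α := ℂ)
  let φ : (S → ℂ) → (Fin N → ℂ) := fun x j => if hj : j ≤ k then (Real.sqrt N : ℂ) * x ⟨⟨(j, k), hj⟩, by simp [hS]⟩ else
    (Real.sqrt N : ℂ) * star (x ⟨⟨(k, j), le_of_not_ge hj⟩, by simp [hS]⟩)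
  let ψ : (T → ℂ) → (Fin N → Fin N → ℂ) := fun x i j => if hij : i = k ∨ j = k then 0 else
    if hle : i ≤ j then x ⟨⟨(i, j), hle⟩, by simp only [hT, Finset.mem_filter, Finset.mem_univ, true_and]; exact hij⟩ else
     star (x ⟨⟨(j, i), le_of_not_ge hle⟩, by simp only [hT, Finset.mem_filter, Finset.mem_univ, true_and]; tauto⟩)
  have hφ : Measurable φ := by
    refine measurable_pi_lambda _ fun j => ?_
    simp only [φ]
    split_ifs with hj
    · exact (measurable_pi_apply _).const_mul _
    · exact (hst.comp (measurable_pi_apply _)).const_mul _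
  have hψ : Measurable ψ := by
    refine measurable_pi_lambda _ fun i => measurable_pi_lambda _ fun j => ?_
    simp only [ψ]
    split_ifs
    · exact measurable_const
    · exact measurable_pi_apply _
    · exact hst.comp (measurable_pi_apply _)
  have h2 := h.comp hφ hψ
  convert h2 using 1
  · ext ω j
    simp only [Function.comp, φ]
    split_ifs with hj
    · rfl
    · rw [wig_star hW]
  · ext ω i j
    simp only [Function.comp, ψ, minor, of_apply]
    split_ifs with h1 h2
    · rfl
    · rfl
    · rw [wig_star hW]

theorem bad_prob_quad {δ₀ D D' : ℝ} (hN : 0 < N) (hW : IsWignerMatrix P N H ν ν') (hC : CondC1 ν ν' δ₀ D D')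
    {c : ℝ} (hc : 0 < c) (hq : ∀ (n : ℕ) (μ : Fin n → Measure ℂ), (∀ i, SG δ₀ (max D D') (μ i)) →
    ∀ (A : Fin n → Fin n → ℂ) (u Fb : ℝ), 0 < Fb → ∑ i, ∑ j, ‖A i j‖ ^ 2 ≤ Fb →
    Measure.pi μ {z | u ≤ ‖Qc μ A z‖} ≤ ENNReal.ofReal (16 * Real.exp (-(c * u / Real.sqrt Fb))))
    {θ δ : ℝ} (hθ : 0 < θ) (hδ : 0 < δ) (k : Fin N) (E : ℝ) {η : ℝ} (hη : 0 < η) :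
    P {ω | θ ≤ Tp k (H ω) E η ∧ δ / 2 * Tp k (H ω) E η ≤
      ‖star (colv k (H ω)) ⬝ᵥ res (minor k (H ω)) E η *ᵥ colv k (H ω) - ptr k (H ω) E η / (N : ℂ)‖} ≤
      ENNReal.ofReal (16 * Real.exp (-(c * δ / 2 * Real.sqrt θ * Real.sqrt (N * η)))) := by
  have hN' : (0 : ℝ) < N := by exact_mod_cast hN
  have hP := hW.prob
  set μ := cmu P H k with hμ
  have hSG : ∀ j, SG δ₀ (max D D') (μ j) := fun j => (cmu_SG hN hW hC k j).1
  have hpr : ∀ j, IsProbabilityMeasure (μ j) := fun j => (hSG j).1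
  set Z : Ω → Fin N → ℂ := fun ω j => (Real.sqrt N : ℂ) * H ω j k with hZ
  set R : Ω → Fin N → Fin N → ℂ := fun ω i j => minor k (H ω) i j with hR
  have hZm : AEMeasurable Z P := aemeasurable_pi_lambda _ fun j => (wig_ae hN hW j k).const_mul _
  have hRm : AEMeasurable R P := by
    refine aemeasurable_pi_lambda _ fun i => aemeasurable_pi_lambda _ fun j => ?_
    simp only [hR, minor, of_apply]
    split_ifs
    · exact aemeasurable_const
    · exact wig_ae hN hW i j
  have hmap := (indepFun_iff_map_prod_eq_prod_map_map hZm hRm).1 (col_indep hN hW k)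
  rw [col_pi hN hW k] at hmap
  have hzm := zres_meas k E η
  have htm := ztp_meas k E η
  set B : Set ((Fin N → ℂ) × (Fin N → Fin N → ℂ)) := {x | θ ≤ ztp k E η x.2 ∧
    ∑ i, ∑ j, ‖zres k E η x.2 i j‖ ^ 2 ≤ N * ztp k E η x.2 / η ∧
    N * (δ / 2 * ztp k E η x.2) ≤ ‖Qc μ (zres k E η x.2) x.1‖} with hB
  have hQm : Measurable (fun x : (Fin N → ℂ) × (Fin N → Fin N → ℂ) => Qc μ (zres k E η x.2) x.1) := by
    have h1 : ∀ i j, Measurable (fun x : (Fin N → ℂ) × (Fin N → Fin N → ℂ) => zres k E η x.2 i j) :=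
      fun i j => (hzm i j).comp measurable_snd
    have h2 : ∀ i, Measurable (fun x : (Fin N → ℂ) × (Fin N → Fin N → ℂ) => x.1 i) :=
      fun i => (measurable_pi_apply i).comp measurable_fst
    have h3 : ∀ i, Measurable (fun x : (Fin N → ℂ) × (Fin N → Fin N → ℂ) => star (x.1 i)) :=
      fun i => (continuous_star.measurable (α := ℂ)).comp (h2 i)
    unfold Qc
    refine Measurable.sub ?_ ?_
    · exact Finset.measurable_fun_sum _ fun i _ => Finset.measurable_fun_sum _ fun j _ =>
        (h1 i j).mul ((h3 i).mul (h2 j))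
    · exact Finset.measurable_fun_sum _ fun i _ => (h1 i i).mul_const _
  have hBm : MeasurableSet B := by
    have h1 : ∀ i j, Measurable (fun x : (Fin N → ℂ) × (Fin N → Fin N → ℂ) => zres k E η x.2 i j) :=
      fun i j => (hzm i j).comp measurable_snd
    have h4 : Measurable (fun x : (Fin N → ℂ) × (Fin N → Fin N → ℂ) => ztp k E η x.2) := htm.comp measurable_snd
    have hBe : B = {x | θ ≤ ztp k E η x.2} ∩ ({x | ∑ i, ∑ j, ‖zres k E η x.2 i j‖ ^ 2 ≤ N * ztp k E η x.2 / η} ∩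
      {x | N * (δ / 2 * ztp k E η x.2) ≤ ‖Qc μ (zres k E η x.2) x.1‖}) := by
      ext x; rfl
    rw [hBe]
    refine (measurableSet_le measurable_const h4).inter ((measurableSet_le ?_ ?_).inter (measurableSet_le ?_ ?_))
    · exact Finset.measurable_fun_sum _ fun i _ => Finset.measurable_fun_sum _ fun j _ => (h1 i j).norm.pow_const 2
    · exact (h4.const_mul _).div_const _
    · exact (h4.const_mul _).const_mul _
    · exact hQm.norm
  have hsub : {ω | θ ≤ Tp k (H ω) E η ∧ δ / 2 * Tp k (H ω) E η ≤
      ‖star (colv k (H ω)) ⬝ᵥ res (minor k (H ω)) E η *ᵥ colv k (H ω) - ptr k (H ω) E η / (N : ℂ)‖} ⊆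
      (fun ω => (Z ω, R ω)) ⁻¹' B := by
    rintro ω ⟨h1, h2⟩
    have e1 : ztp k E η (R ω) = Tp k (H ω) E η := ztp_eq k E η (H ω)
    refine ⟨?_, ?_, ?_⟩
    · simp only [e1]; exact h1
    · exact zF hN k E hη (hW.herm ω)
    · simp only [e1]
      rw [quad_zres hN k E η (H ω) μ (fun j hj => (cmu_SG hN hW hC k j).2 hj)] at h2
      rw [norm_div, Complex.norm_natCast, le_div_iff₀ hN'] at h2
      rw [mul_comm]
      exact h2
  refine (measure_mono hsub).trans ?_
  rw [← Measure.map_apply_of_aemeasurable (hZm.prodMk hRm) hBm, hmap, Measure.prod_apply_symm hBm]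
  have hRp : IsProbabilityMeasure (P.map R) := Measure.isProbabilityMeasure_map hRm
  calc _ ≤ ∫⁻ _y, ENNReal.ofReal (16 * Real.exp (-(c * δ / 2 * Real.sqrt θ * Real.sqrt (N * η)))) ∂P.map R := by
        refine lintegral_mono fun y => ?_
        by_cases hy : θ ≤ ztp k E η y ∧ ∑ i, ∑ j, ‖zres k E η y i j‖ ^ 2 ≤ N * ztp k E η y / η
        · obtain ⟨hy1, hy2⟩ := hy
          set T := ztp k E η y with hT
          have hT0 : 0 < T := hθ.trans_le hy1
          refine (measure_mono fun z hz => ?_).trans ((hq N μ hSG (zres k E η y) (N * (δ / 2 * T)) (N * T / η) (by positivity) hy2).trans ?_)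
          · exact hz.2.2
          · apply ENNReal.ofReal_le_ofReal
            apply mul_le_mul_of_nonneg_left _ (by norm_num)
            apply Real.exp_le_exp.2
            apply neg_le_neg
            rw [le_div_iff₀ (Real.sqrt_pos.2 (by positivity))]
            have e : Real.sqrt θ * Real.sqrt (N * η) * Real.sqrt (N * T / η) ≤ N * T := by
              rw [← Real.sqrt_mul hθ.le, ← Real.sqrt_mul (by positivity)]
              apply Real.sqrt_le_iff.2
              refine ⟨by positivity, ?_⟩
              have : θ * (N * η) * (N * T / η) = N ^ 2 * T * θ := by field_simp
              rw [this]
              nlinarith [mul_le_mul_of_nonneg_left hy1 (by positivity : 0 ≤ (N : ℝ) ^ 2 * T)]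
            calc c * δ / 2 * Real.sqrt θ * Real.sqrt (N * η) * Real.sqrt (N * T / η) =
                c * δ / 2 * (Real.sqrt θ * Real.sqrt (N * η) * Real.sqrt (N * T / η)) := by ring
              _ ≤ c * δ / 2 * (N * T) := by gcongr
              _ = _ := by ring
        · have : (fun x => (x, y)) ⁻¹' B = ∅ := by
            ext x
            simp only [Set.mem_preimage, Set.mem_empty_iff_false, iff_false]
            intro hx
            exact hy ⟨hx.1, hx.2.1⟩
          rw [this]; simp
    _ = _ := by simp

theorem diag_prob {δ₀ D D' : ℝ} (hN : 0 < N) (hW : IsWignerMatrix P N H ν ν') (hC : CondC1 ν ν' δ₀ D D')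
    {s : ℝ} (hs : 0 < s) (k : Fin N) :
    P {ω | s ≤ ‖H ω k k‖} ≤ ENNReal.ofReal (|D'| * Real.exp (-(δ₀ * s ^ 2 * N))) := by
  have hN' : (0 : ℝ) < N := by exact_mod_cast hN
  have hδ := hC.1
  have hae : AEMeasurable (fun ω => Real.sqrt N * (H ω k k).re) P :=
        (Complex.measurable_re.comp_aemeasurable (wig_ae hN hW k k)).const_mul _
  have h4 := meas_ge_le_lintegral_div (μ := ν') (f := fun x => ENNReal.ofReal (Real.exp (δ₀ * x ^ 2)))
    (by fun_prop) (ε := ENNReal.ofReal (Real.exp (δ₀ * s ^ 2 * N))) (by simp [Real.exp_pos]) ENNReal.ofReal_ne_top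
  have hm : MeasurableSet {x : ℝ | ENNReal.ofReal (Real.exp (δ₀ * s ^ 2 * N)) ≤ ENNReal.ofReal (Real.exp (δ₀ * x ^ 2))} :=
    measurableSet_le measurable_const (by fun_prop)
  rw [← hW.diag k, Measure.map_apply_of_aemeasurable hae hm, hW.diag k] at h4
  refine (measure_mono fun ω hω => ?_).trans (h4.trans ?_)
  · simp only [Set.mem_ofPred_eq, Set.mem_preimage] at hω ⊢
    apply ENNReal.ofReal_le_ofReal
    apply Real.exp_le_exp.2
    rw [wig_diag_eq hW, Complex.norm_real, Real.norm_eq_abs] at hω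
    rw [mul_pow, Real.sq_sqrt hN'.le, ← sq_abs (H ω k k).re]
    have : s ^ 2 ≤ |(H ω k k).re| ^ 2 := pow_le_pow_left₀ hs.le hω 2
    calc δ₀ * s ^ 2 * N ≤ δ₀ * |(H ω k k).re| ^ 2 * N := by gcongr
      _ = _ := by ring
  · refine (ENNReal.div_le_div_right (hC.2.2.trans (ENNReal.ofReal_le_ofReal (le_abs_self D'))) _).trans (le_of_eq ?_)
    rw [← ENNReal.ofReal_div_of_pos (Real.exp_pos _), Real.exp_neg, div_eq_mul_inv]

end PB2

theorem bad_prob {δ₀ : ℝ} (hδ₀ : 0 < δ₀) (D D' : ℝ) {θ δ : ℝ} (hθ : 0 < θ) (hδ : 0 < δ) :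
    ∃ C c : ℝ, 0 < C ∧ 0 < c ∧ ∀ (N : ℕ) (Ω : Type) (_ : MeasurableSpace Ω) (P : Measure Ω)
      (H : Ω → Matrix (Fin N) (Fin N) ℂ) (ν : Measure ℂ) (ν' : Measure ℝ), 0 < N → IsWignerMatrix P N H ν ν' →
      CondC1 ν ν' δ₀ D D' → ∀ (k : Fin N) (E η : ℝ), 0 < η → η ≤ 1 →
      P {ω | bad θ δ k (H ω) E η} ≤ ENNReal.ofReal (C * Real.exp (-(c * Real.sqrt (N * η)))) := by
  obtain ⟨c, hc, hq⟩ := quad_tail δ₀ (max D D') hδ₀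
  set c1 := c * δ / 2 * Real.sqrt θ with hc1
  set c2 := δ₀ * (δ / 2 * θ) ^ 2 with hc2
  have hc1p : 0 < c1 := by have := Real.sqrt_pos.2 hθ; positivity
  have hc2p : 0 < c2 := by positivity
  refine ⟨16 + |D'|, min c1 c2, by positivity, lt_min hc1p hc2p, ?_⟩
  intro N Ω _ P H ν ν' hN hW hC k E η hη hη1
  have hN' : (1 : ℝ) ≤ N := by exact_mod_cast hN
  have h1 := bad_prob_quad hN hW hC hc hq hθ hδ k E hη
  have h2 := diag_prob hN hW hC (s := δ / 2 * θ) (by positivity) k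
  have hsub : {ω | bad θ δ k (H ω) E η} ⊆ {ω | θ ≤ Tp k (H ω) E η ∧ δ / 2 * Tp k (H ω) E η ≤
      ‖star (colv k (H ω)) ⬝ᵥ res (minor k (H ω)) E η *ᵥ colv k (H ω) - ptr k (H ω) E η / (N : ℂ)‖} ∪
      {ω | δ / 2 * θ ≤ ‖H ω k k‖} := by
    rintro ω ⟨b1, b2⟩
    by_contra hcon
    simp only [Set.mem_union, Set.mem_ofPred_eq] at hcon
    push Not at hcon
    obtain ⟨a1, a2⟩ := hcon
    have a1 := a1 b1
    have h3 := norm_sub_le (H ω k k) (star (colv k (H ω)) ⬝ᵥ res (minor k (H ω)) E η *ᵥ colv k (H ω) - ptr k (H ω) E η / (N : ℂ))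
    simp only [Om, Fintype.card_fin] at b2
    have : δ / 2 * θ ≤ δ / 2 * Tp k (H ω) E η := by gcongr
    linarith
  refine (measure_mono hsub).trans ((measure_union_le _ _).trans ((add_le_add h1 h2).trans ?_))
  rw [← ENNReal.ofReal_add (by positivity) (by positivity)]
  apply ENNReal.ofReal_le_ofReal
  set r := Real.sqrt (N * η) with hr
  have hr0 : 0 ≤ r := Real.sqrt_nonneg _
  have hrN : r ≤ N := by
    apply Real.sqrt_le_iff.2
    refine ⟨by linarith, ?_⟩
    nlinarith
  have e1 : Real.exp (-(c1 * r)) ≤ Real.exp (-(min c1 c2 * r)) := by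
    apply Real.exp_le_exp.2
    nlinarith [mul_le_mul_of_nonneg_right (min_le_left c1 c2) hr0]
  have e2 : Real.exp (-(c2 * N)) ≤ Real.exp (-(min c1 c2 * r)) := by
    apply Real.exp_le_exp.2
    have := mul_le_mul (min_le_right c1 c2) hrN hr0 hc2p.le
    linarith
  have e3 := mul_le_mul_of_nonneg_left e2 (abs_nonneg D')
  nlinarith

section Fin1

theorem geo_exp (q c : ℝ) (hc : 0 < c) : ∃ C : ℝ, 0 < C ∧ ∀ x : ℝ, 1 ≤ x → ∀ J : ℕ,
    ∑ l ∈ Finset.range (J + 1), ((2 : ℝ) ^ l) ^ q * Real.exp (-(c * Real.sqrt (x * 2 ^ l))) ≤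
      C * Real.exp (-(c / 2 * Real.sqrt x)) := by
  obtain ⟨m, hm⟩ := exists_nat_ge (2 * q + 2)
  set B : ℝ := m.factorial / (c / 2) ^ m with hB
  have hBp : 0 < B := by positivity
  refine ⟨2 * B, by positivity, ?_⟩
  intro x hx J
  have hterm : ∀ l : ℕ, ((2 : ℝ) ^ l) ^ q * Real.exp (-(c * Real.sqrt (x * 2 ^ l))) ≤
      (B * Real.exp (-(c / 2 * Real.sqrt x))) * (1 / 2) ^ l := by
    intro l
    have h2l : (1 : ℝ) ≤ 2 ^ l := one_le_pow₀ (by norm_num)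
    set t := Real.sqrt (2 ^ l) with ht
    have ht1 : 1 ≤ t := Real.one_le_sqrt.2 h2l
    have hs1 : 1 ≤ Real.sqrt x := Real.one_le_sqrt.2 hx
    have htt : t ^ 2 = 2 ^ l := Real.sq_sqrt (by positivity)
    have h1 : Real.exp (-(c * Real.sqrt (x * 2 ^ l))) ≤ Real.exp (-(c / 2 * Real.sqrt x)) * Real.exp (-(c / 2 * t)) := by
      rw [← Real.exp_add]
      apply Real.exp_le_exp.2
      rw [Real.sqrt_mul (by linarith)]
      have : (Real.sqrt x + t) / 2 ≤ Real.sqrt x * t := by nlinarith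
      nlinarith [mul_le_mul_of_nonneg_left this hc.le]
    have h2 : ((2 : ℝ) ^ l) ^ q * Real.exp (-(c / 2 * t)) ≤ B * (1 / 2) ^ l := by
      have e1 : ((2 : ℝ) ^ l) ^ q * 2 ^ l = t ^ (2 * q + 2) := by
        rw [← htt, Real.rpow_add (by linarith), Real.rpow_mul (by linarith)]
        norm_num
      have e2 : t ^ (2 * q + 2) ≤ t ^ m := by
        rw [← Real.rpow_natCast]
        exact Real.rpow_le_rpow_of_exponent_le ht1 hm
      have e3 : t ^ m ≤ B * Real.exp (c / 2 * t) := by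
        have := Real.pow_div_factorial_le_exp (c / 2 * t) (by positivity) m
        rw [hB, div_mul_eq_mul_div, le_div_iff₀ (by positivity)]
        rw [div_le_iff₀ (by positivity), mul_pow] at this
        linarith
      rw [one_div, inv_pow, ← div_eq_mul_inv, le_div_iff₀ (by positivity), Real.exp_neg]
      calc _ = (((2 : ℝ) ^ l) ^ q * 2 ^ l) * (Real.exp (c / 2 * t))⁻¹ := by ring
        _ ≤ (B * Real.exp (c / 2 * t)) * (Real.exp (c / 2 * t))⁻¹ := by
          rw [e1]; gcongr; exact e2.trans e3
        _ = B := by rw [mul_assoc, mul_inv_cancel₀ (Real.exp_pos _).ne', mul_one]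
    calc _ ≤ ((2 : ℝ) ^ l) ^ q * (Real.exp (-(c / 2 * Real.sqrt x)) * Real.exp (-(c / 2 * t))) := by gcongr
      _ = Real.exp (-(c / 2 * Real.sqrt x)) * (((2 : ℝ) ^ l) ^ q * Real.exp (-(c / 2 * t))) := by ring
      _ ≤ Real.exp (-(c / 2 * Real.sqrt x)) * (B * (1 / 2) ^ l) := by gcongr
      _ = _ := by ring
  refine (Finset.sum_le_sum fun l _ => hterm l).trans ?_
  rw [← Finset.mul_sum]
  have : ∑ l ∈ Finset.range (J + 1), (1 / 2 : ℝ) ^ l ≤ 2 := by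
    have := sum_geometric_two_le (J + 1)
    exact this
  have hp : 0 < B * Real.exp (-(c / 2 * Real.sqrt x)) := by positivity
  nlinarith

open scoped Classical in
theorem markov_sets {Ω ι : Type*} [MeasurableSpace Ω] (P : Measure Ω) (s : Finset ι) (B : ι → Set Ω) (w b : ι → ℝ)
    (hw : ∀ i ∈ s, 0 ≤ w i) (hb : ∀ i ∈ s, 0 ≤ b i) (hP : ∀ i ∈ s, P (B i) ≤ ENNReal.ofReal (b i)) {t : ℝ} (ht : 0 < t) :
    P {ω | t ≤ ∑ i ∈ s, w i * (if ω ∈ B i then 1 else 0)} ≤ ENNReal.ofReal ((∑ i ∈ s, w i * b i) / t) := by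
  set f : Ω → ℝ≥0∞ := fun ω => ∑ i ∈ s, ENNReal.ofReal (w i) * (toMeasurable P (B i)).indicator 1 ω with hf
  have hi : ∀ i, Measurable ((toMeasurable P (B i)).indicator (1 : Ω → ℝ≥0∞)) := fun i =>
    measurable_one.indicator (measurableSet_toMeasurable P (B i))
  have hfm : Measurable f := Finset.measurable_fun_sum _ fun i _ => (hi i).const_mul _
  have h4 := meas_ge_le_lintegral_div (μ := P) hfm.aemeasurable (ε := ENNReal.ofReal t) (by simpa using ht) ENNReal.ofReal_ne_top
  refine (measure_mono fun ω hω => ?_).trans (h4.trans ?_)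
  · simp only [Set.mem_ofPred_eq] at hω ⊢
    refine (ENNReal.ofReal_le_ofReal hω).trans ?_
    rw [ENNReal.ofReal_sum_of_nonneg fun i hi => mul_nonneg (hw i hi) (by split_ifs <;> norm_num)]
    simp only [hf]
    refine Finset.sum_le_sum fun i hi => ?_
    rw [ENNReal.ofReal_mul (hw i hi)]
    gcongr
    split_ifs with h
    · rw [Set.indicator_of_mem (subset_toMeasurable P (B i) h)]; simp
    · simp
  · rw [ENNReal.ofReal_div_of_pos ht]
    apply ENNReal.div_le_div_right
    simp only [hf]
    rw [lintegral_finsetSum _ fun i _ => (hi i).const_mul _, ENNReal.ofReal_sum_of_nonneg fun i hi => mul_nonneg (hw i hi) (hb i hi)]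
    refine Finset.sum_le_sum fun i his => ?_
    rw [lintegral_const_mul _ (hi i), lintegral_indicator_one (measurableSet_toMeasurable P (B i)), measure_toMeasurable,
      ENNReal.ofReal_mul (hw i his)]
    gcongr
    exact hP i his

end Fin1

section Fin2

open scoped Classical in
theorem wsum_prob {Ω : Type*} [MeasurableSpace Ω] (P : Measure Ω) {N : ℕ} (hN : 0 < N) (B : Fin N → ℕ → Set Ω)
    {C1 c1 q S x t : ℝ} (hC1 : 0 < C1) (j : ℕ)
    (hP : ∀ k, ∀ i ≤ j, P (B k i) ≤ ENNReal.ofReal (C1 * Real.exp (-(c1 * Real.sqrt (x * 2 ^ (j - i))))))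
    (hS : ∑ l ∈ Finset.range (j + 1), ((2 : ℝ) ^ l) ^ q * Real.exp (-(c1 * Real.sqrt (x * 2 ^ l))) ≤
      S * Real.exp (-(c1 / 2 * Real.sqrt x))) (ht : 0 < t) :
    P {ω | t * N ≤ ∑ k : Fin N, ∑ i ∈ Finset.range (j + 1), ((2 : ℝ) ^ (j - i)) ^ q * (if ω ∈ B k i then (1 : ℝ) else 0)} ≤
      ENNReal.ofReal (C1 * S / t * Real.exp (-(c1 / 2 * Real.sqrt x))) := by
  have hN' : (0 : ℝ) < N := by exact_mod_cast hN
  have h := markov_sets P ((Finset.univ : Finset (Fin N)) ×ˢ Finset.range (j + 1)) (fun a => B a.1 a.2)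
    (fun a => ((2 : ℝ) ^ (j - a.2)) ^ q) (fun a => C1 * Real.exp (-(c1 * Real.sqrt (x * 2 ^ (j - a.2)))))
    (fun i _ => by positivity) (fun i _ => by positivity)
    (fun i hi => hP i.1 i.2 (by
      have := (Finset.mem_product.1 hi).2
      rw [Finset.mem_range] at this; omega)) (t := t * N) (by positivity)
  simp only [Finset.sum_product] at h
  refine h.trans (ENNReal.ofReal_le_ofReal ?_)
  rw [Finset.sum_const, Finset.card_univ, Fintype.card_fin, nsmul_eq_mul, div_le_iff₀ (by positivity)]
  have e : ∑ i ∈ Finset.range (j + 1), ((2 : ℝ) ^ (j - i)) ^ q * (C1 * Real.exp (-(c1 * Real.sqrt (x * 2 ^ (j - i))))) =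
      C1 * ∑ l ∈ Finset.range (j + 1), ((2 : ℝ) ^ l) ^ q * Real.exp (-(c1 * Real.sqrt (x * 2 ^ l))) := by
    rw [Finset.mul_sum, ← Finset.sum_range_reflect]
    refine Finset.sum_congr rfl fun i hi => ?_
    rw [Finset.mem_range] at hi
    have e1 : j - (j + 1 - 1 - i) = i := by omega
    rw [e1]; ring
  rw [e]
  have h2 := mul_le_mul_of_nonneg_left hS hC1.le
  calc _ ≤ N * (C1 * (S * Real.exp (-(c1 / 2 * Real.sqrt x)))) := by gcongr
    _ = _ := by field_simp

open scoped Classical in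
theorem det_final {N : ℕ} (hN : 0 < N) {H : Matrix (Fin N) (Fin N) ℂ} (hH : H.IsHermitian) (J : ℕ)
    {c κ E x0 δ' p M μ : ℝ} (hc : 0 < c) (hc1 : c ≤ 1 / 2) (hκ : 0 < κ) (hκ1 : κ ≤ 1) (hcκ : 4 * c ^ 2 ≤ κ / 2)
    (hE : E ^ 2 / 4 ≤ 1 - κ) (hx0 : x0 = 64 / (c * κ)) (hNJ : x0 ≤ N * (2 * c / 2 ^ J))
    (hδ' : δ' = κ / (16 * (1 + (3 + 16 / c) * (8 / c))))
    (hZ : ∀ j ≤ J, (∑ k, zrec (fun i => bad (c / 4) (κ / 16) k H E (2 * c / 2 ^ i)) j) / N ≤ δ')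
    (hM : 0 < M) (hp : 2 ≤ p) (hQ : N * (2 * c / 2 ^ J) ≤ c * M ^ 2 / 64)
    (hμ : |μ - E| ≤ 2 * c / 2 ^ J) (v : Fin N → ℂ) (hv : ∑ i, ‖v i‖ ^ 2 = 1) (hv' : H.mulVec v = (μ : ℂ) • v)
    (hv3 : M * (N : ℝ) ^ (1 / p - 1 / 2) ≤ (∑ i, ‖v i‖ ^ p) ^ (1 / p)) :
    (2 : ℝ) ^ (-(p / 2)) * N ≤ ∑ k : Fin N, ∑ i ∈ Finset.range (J + 1),
      ((2 : ℝ) ^ (J - i)) ^ (p / 2) * (if bad (c / 4) (κ / 16) k H E (2 * c / 2 ^ i) then (1 : ℝ) else 0) := by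
  have : Nonempty (Fin N) := ⟨⟨0, hN⟩⟩
  have hN' : (0 : ℝ) < N := by exact_mod_cast hN
  set f : Fin N → ℕ → Prop := fun k i => bad (c / 4) (κ / 16) k H E (2 * c / 2 ^ i) with hf
  have hsc := (scales hH J hc hc1 hκ hκ1 hcκ hE hx0 (by simpa using hNJ) hδ' (by simpa using hZ) J le_rfl).2
  set η := 2 * c / 2 ^ J with hη
  have hηp : 0 < η := by positivity
  set A := M ^ 2 / (4 * N) with hA
  have hAp : 0 < A := by positivity
  set q := p / 2 with hq
  have hq1 : 1 ≤ q := by rw [hq]; linarith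
  set W : Fin N → ℝ := fun k => ∑ i ∈ Finset.range (J + 1), ((2 : ℝ) ^ (J - i)) ^ q * (if f k i then (1 : ℝ) else 0) with hW
  have hvk : ∀ k, ‖v k‖ ^ p ≤ A ^ q * (1 + 2 ^ q * W k) := by
    intro k
    have h1 := eig_bound hH k E μ hηp hμ v hv hv'
    have h2 := hsc k
    have hz := zrec_nonneg (f k) J
    have h3 : ‖v k‖ ^ 2 ≤ A * (1 + zrec (f k) J) := by
      calc _ ≤ 2 * η * (1 / Yk k H E η) := by rw [mul_one_div]; exact h1
        _ ≤ 2 * η * (8 / c * (1 + zrec (f k) J)) := by gcongr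
        _ = (16 * η / c) * (1 + zrec (f k) J) := by ring
        _ ≤ A * (1 + zrec (f k) J) := by
          gcongr
          rw [hA, div_le_div_iff₀ hc (by positivity)]
          linarith
    have h4 : ‖v k‖ ^ p = (‖v k‖ ^ 2) ^ q := by
      rw [← Real.rpow_natCast, ← Real.rpow_mul (norm_nonneg _), hq]
      congr 1; push_cast; ring
    rw [h4]
    calc (‖v k‖ ^ 2) ^ q ≤ (A * (1 + zrec (f k) J)) ^ q := by
          apply Real.rpow_le_rpow (by positivity) h3 (by linarith)
      _ = A ^ q * (1 + zrec (f k) J) ^ q := Real.mul_rpow hAp.le (by linarith)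
      _ ≤ A ^ q * (1 + 2 ^ q * W k) := by
        gcongr
        refine (zrec_pow (f k) J (by linarith)).trans (le_of_eq ?_)
        rw [hW, Finset.mul_sum]
        congr 1
        refine Finset.sum_congr rfl fun i _ => ?_
        rw [Real.mul_rpow (by norm_num) (by positivity)]
        ring
  have hsum : ∑ i, ‖v i‖ ^ p ≤ A ^ q * (N + 2 ^ q * ∑ k, W k) := by
    refine (Finset.sum_le_sum fun k _ => hvk k).trans (le_of_eq ?_)
    rw [← Finset.mul_sum, Finset.sum_add_distrib, ← Finset.mul_sum]
    simp
  have hsn : 0 ≤ ∑ i, ‖v i‖ ^ p := Finset.sum_nonneg fun i _ => by positivity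
  have hlow : N * (4 ^ q * A ^ q) ≤ ∑ i, ‖v i‖ ^ p := by
    have h1 := Real.rpow_le_rpow (by positivity) hv3 (by linarith : 0 ≤ p)
    rw [← Real.rpow_mul hsn, one_div_mul_cancel (by linarith), Real.rpow_one] at h1
    refine le_trans (le_of_eq ?_) h1
    rw [← Real.mul_rpow (by norm_num) hAp.le, Real.mul_rpow hM.le (by positivity), ← Real.rpow_mul hN'.le]
    have e1 : 4 * A = M ^ 2 / N := by rw [hA]; field_simp
    have e2 : (1 / p - 1 / 2) * p = 1 - q := by rw [hq]; field_simp
    have e3 : M ^ p = (M ^ 2) ^ q := by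
      rw [← Real.rpow_natCast, ← Real.rpow_mul hM.le, hq]
      congr 1; push_cast; ring
    rw [e1, e2, e3, Real.div_rpow (by positivity) hN'.le, Real.rpow_sub hN', Real.rpow_one]
    ring
  have hAq : 0 < A ^ q := by positivity
  have h5 : (N : ℝ) * 4 ^ q ≤ N + 2 ^ q * ∑ k, W k := by
    have := hlow.trans hsum
    rw [← mul_assoc, mul_comm] at this
    exact le_of_mul_le_mul_left this hAq
  have h6 : (2 : ℝ) ≤ 4 ^ q := by
    calc (2 : ℝ) ≤ 4 ^ (1 : ℝ) := by norm_num
      _ ≤ 4 ^ q := Real.rpow_le_rpow_of_exponent_le (by norm_num) hq1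
  rw [Real.rpow_neg (by norm_num), inv_mul_le_iff₀ (by positivity)]
  nlinarith

end Fin2

section Fin3

theorem core_bound {δ₀ : ℝ} (hδ₀ : 0 < δ₀) (D D' : ℝ) {c κ p x0 : ℝ} (hc : 0 < c) (hc1 : c ≤ 1 / 2) (hκ : 0 < κ)
    (hκ1 : κ ≤ 1) (hcκ : 4 * c ^ 2 ≤ κ / 2) (hx0 : x0 = 64 / (c * κ)) (hp : 2 ≤ p) :
    ∃ C c' : ℝ, 0 < C ∧ 0 < c' ∧ ∀ (N : ℕ) (Ω : Type) (_ : MeasurableSpace Ω) (P : Measure Ω)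
      (H : Ω → Matrix (Fin N) (Fin N) ℂ) (ν : Measure ℂ) (ν' : Measure ℝ), 0 < N → IsWignerMatrix P N H ν ν' →
      CondC1 ν ν' δ₀ D D' → ∀ (E M : ℝ) (J : ℕ), E ^ 2 / 4 ≤ 1 - κ → x0 ≤ N * (2 * c / 2 ^ J) →
      1 ≤ N * (2 * c / 2 ^ J) → 0 < M → N * (2 * c / 2 ^ J) ≤ c * M ^ 2 / 64 →
      P {ω | ∃ μ : ℝ, |μ - E| ≤ 2 * c / 2 ^ J ∧ ∃ v : Fin N → ℂ, (∑ i, ‖v i‖ ^ 2) = 1 ∧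
            (H ω).mulVec v = (μ : ℂ) • v ∧ M * (N : ℝ) ^ (1 / p - 1 / 2) ≤ (∑ i, ‖v i‖ ^ p) ^ (1 / p)} ≤
        ENNReal.ofReal (C * Real.exp (-(c' * Real.sqrt (N * (2 * c / 2 ^ J))))) := by
  classical
  obtain ⟨C1, c1, hC1, hc1p, hbad⟩ := bad_prob hδ₀ D D' (θ := c / 4) (δ := κ / 16) (by positivity) (by positivity)
  obtain ⟨S1, hS1, hS1'⟩ := geo_exp 1 c1 hc1p
  obtain ⟨Sq, hSq, hSq'⟩ := geo_exp (p / 2) c1 hc1p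
  obtain ⟨S0, hS0, hS0'⟩ := geo_exp 0 (c1 / 2) (by positivity)
  set δ' := κ / (16 * (1 + (3 + 16 / c) * (8 / c))) with hδ'
  have hδp : 0 < δ' := by positivity
  set t : ℝ := (2 : ℝ) ^ (-(p / 2)) with ht
  have htp : 0 < t := by positivity
  refine ⟨C1 * S1 / δ' * S0 + C1 * Sq / t, c1 / 4, by positivity, by positivity, ?_⟩
  intro N Ω _ P H ν ν' hN hW hC E M J hE hNx hN1 hM hQ
  have hN' : (0 : ℝ) < N := by exact_mod_cast hN
  set X := (N : ℝ) * (2 * c / 2 ^ J) with hX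
  set B : Fin N → ℕ → Set Ω := fun k i => {ω | bad (c / 4) (κ / 16) k (H ω) E (2 * c / 2 ^ i)} with hB
  have hscale : ∀ j, ∀ i ≤ j, (N : ℝ) * (2 * c / 2 ^ i) = N * (2 * c / 2 ^ j) * 2 ^ (j - i) := by
    intro j i hij
    obtain ⟨d, rfl⟩ := Nat.exists_eq_add_of_le hij
    rw [Nat.add_sub_cancel_left, pow_add]
    field_simp
  have hBP : ∀ j, ∀ k, ∀ i ≤ j, P (B k i) ≤
      ENNReal.ofReal (C1 * Real.exp (-(c1 * Real.sqrt ((N * (2 * c / 2 ^ j)) * 2 ^ (j - i))))) := by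
    intro j k i hij
    rw [← hscale j i hij]
    refine hbad N Ω _ P H ν ν' hN hW hC k E _ (by positivity) ?_
    rw [div_le_one (by positivity)]
    have : (1 : ℝ) ≤ 2 ^ i := one_le_pow₀ (by norm_num)
    linarith
  have hge : ∀ j ≤ J, 1 ≤ (N : ℝ) * (2 * c / 2 ^ j) := by
    intro j hj
    rw [hscale J j hj]
    have : (1 : ℝ) ≤ 2 ^ (J - j) := one_le_pow₀ (by norm_num)
    nlinarith
  set Z : ℕ → Set Ω := fun j => {ω | δ' * N ≤ ∑ k : Fin N, ∑ i ∈ Finset.range (j + 1),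
    ((2 : ℝ) ^ (j - i)) ^ (1 : ℝ) * (if ω ∈ B k i then (1 : ℝ) else 0)} with hZ
  set V : Set Ω := {ω | t * N ≤ ∑ k : Fin N, ∑ i ∈ Finset.range (J + 1),
    ((2 : ℝ) ^ (J - i)) ^ (p / 2) * (if ω ∈ B k i then (1 : ℝ) else 0)} with hV
  have hPZ : ∀ j ∈ Finset.range (J + 1), P (Z j) ≤
      ENNReal.ofReal (C1 * S1 / δ' * Real.exp (-(c1 / 2 * Real.sqrt (X * 2 ^ (J - j))))) := by
    intro j hj
    have hj' : j ≤ J := by rw [Finset.mem_range] at hj; omega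
    have := wsum_prob P hN B hC1 j (hBP j) (hS1' _ (hge j hj') j) hδp
    rwa [hscale J j hj'] at this
  have hPV : P V ≤ ENNReal.ofReal (C1 * Sq / t * Real.exp (-(c1 / 2 * Real.sqrt X))) :=
    wsum_prob P hN B hC1 J (hBP J) (hSq' _ (hge J le_rfl) J) htp
  have hsub : {ω | ∃ μ : ℝ, |μ - E| ≤ 2 * c / 2 ^ J ∧ ∃ v : Fin N → ℂ, (∑ i, ‖v i‖ ^ 2) = 1 ∧
      (H ω).mulVec v = (μ : ℂ) • v ∧ M * (N : ℝ) ^ (1 / p - 1 / 2) ≤ (∑ i, ‖v i‖ ^ p) ^ (1 / p)} ⊆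
      (⋃ j ∈ Finset.range (J + 1), Z j) ∪ V := by
    rintro ω ⟨μ, hμ, v, hv1, hv2, hv3⟩
    by_cases hin : ω ∈ ⋃ j ∈ Finset.range (J + 1), Z j
    · exact Or.inl hin
    right
    refine det_final hN (hW.herm ω) J hc hc1 hκ hκ1 hcκ hE hx0 hNx hδ' ?_ hM hp hQ hμ v hv1 hv2 hv3
    intro j hj
    simp only [Set.mem_iUnion, not_exists] at hin
    have h1 := hin j (Finset.mem_range.2 (by omega))
    simp only [hZ, Set.mem_ofPred_eq, not_le] at h1
    rw [div_le_iff₀ hN']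
    refine le_trans (le_of_eq ?_) h1.le
    refine Finset.sum_congr rfl fun k _ => ?_
    rw [zrec_sum]
    refine Finset.sum_congr rfl fun i _ => ?_
    rw [Real.rpow_one]
    rfl
  refine (measure_mono hsub).trans ((measure_union_le _ _).trans ?_)
  have hZs : P (⋃ j ∈ Finset.range (J + 1), Z j) ≤ ENNReal.ofReal (C1 * S1 / δ' * S0 * Real.exp (-(c1 / 4 * Real.sqrt X))) := by
    refine (measure_biUnion_finset_le _ _).trans ((Finset.sum_le_sum hPZ).trans ?_)
    rw [← ENNReal.ofReal_sum_of_nonneg fun i _ => by positivity]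
    apply ENNReal.ofReal_le_ofReal
    rw [← Finset.mul_sum, mul_assoc]
    gcongr
    have h := hS0' X hN1 J
    rw [← Finset.sum_range_reflect] at h
    have e : c1 / 2 / 2 = c1 / 4 := by ring
    rw [e] at h
    refine le_trans (le_of_eq ?_) h
    refine Finset.sum_congr rfl fun i hi => ?_
    rw [Real.rpow_zero, one_mul]
    simp
  refine (add_le_add hZs hPV).trans ?_
  rw [← ENNReal.ofReal_add (by positivity) (by positivity)]
  apply ENNReal.ofReal_le_ofReal
  rw [add_mul]
  gcongr
  norm_num

set_option maxHeartbeats 2000000 in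
theorem final_bound :
    ∀ κ K p δ₀ D D' : ℝ, 0 < κ → 0 < K → 2 ≤ p →
    ∃ C c : ℝ, 0 < C ∧ 0 < c ∧
    ∀ (N : ℕ) (Ω : Type) (_ : MeasurableSpace Ω) (P : Measure Ω)
      (H : Ω → Matrix (Fin N) (Fin N) ℂ) (ν : Measure ℂ) (ν' : Measure ℝ),
      2 ≤ N →
      IsWignerMatrix P N H ν ν' →
      CondC1 ν ν' δ₀ D D' →
      ∀ a b : ℝ, -2 + κ ≤ a → a ≤ b → b ≤ 2 - κ → b - a = K / N →
      ∀ M : ℝ, 0 ≤ M →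
        P {ω | ∃ μ ∈ Set.Icc a b, ∃ v : Fin N → ℂ,
            (∑ i, ‖v i‖ ^ 2) = 1 ∧
            (H ω).mulVec v = (μ : ℂ) • v ∧
            M * (N : ℝ) ^ (1 / p - 1 / 2) ≤ (∑ i, ‖v i‖ ^ p) ^ (1 / p)}
          ≤ ENNReal.ofReal (C * Real.exp (-(c * Real.sqrt M))) := by
  intro κ K p δ₀ D D' hκ hK hp
  by_cases hδ₀ : 0 < δ₀
  swap
  · exact ⟨1, 1, one_pos, one_pos, fun N Ω _ P H ν ν' _ _ hC => absurd hC.1 hδ₀⟩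
  set κ1 := min (κ / 2) 1 with hκ1
  have hκ1p : 0 < κ1 := lt_min (by positivity) one_pos
  have hκ1le : κ1 ≤ 1 := min_le_right _ _
  have hκ1le' : κ1 ≤ κ / 2 := min_le_left _ _
  set c := κ1 / 8 with hc
  have hcp : 0 < c := by positivity
  have hc12 : c ≤ 1 / 2 := by rw [hc]; linarith
  have hc14 : c ≤ 1 / 8 := by rw [hc]; linarith
  have hcκ : 4 * c ^ 2 ≤ κ1 / 2 := by rw [hc]; nlinarith
  set x0 := 64 / (c * κ1) with hx0
  have hx0p : 0 < x0 := by positivity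
  obtain ⟨C, c', hC, hc', hcore⟩ := core_bound hδ₀ D D' hcp hc12 hκ1p hκ1le hcκ hx0 hp
  set M0 : ℝ := 128 * (x0 + K + 1) / c + 1 with hM0
  have hM01 : 1 ≤ M0 := by
    have : 0 < 128 * (x0 + K + 1) / c := by positivity
    linarith
  set c3 := c' * Real.sqrt (c / 128) with hc3
  have hsq : 0 < Real.sqrt (c / 128) := Real.sqrt_pos.2 (by positivity)
  have hc3p : 0 < c3 := by positivity
  refine ⟨C + Real.exp (c3 * Real.sqrt M0), c3, by positivity, hc3p, ?_⟩
  intro N Ω _ P H ν ν' hN hW hCC a b ha hab hb hlen M hM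
  have hN' : (2 : ℝ) ≤ N := by exact_mod_cast hN
  have hprob := hW.prob
  rcases lt_or_ge M M0 with hlt | hge
  · refine prob_le_one.trans ?_
    rw [← ENNReal.ofReal_one]
    apply ENNReal.ofReal_le_ofReal
    have h1 : Real.exp (c3 * Real.sqrt M0) * Real.exp (-(c3 * Real.sqrt M)) ≥ 1 := by
      rw [← Real.exp_add]
      apply Real.one_le_exp
      have := Real.sqrt_le_sqrt hlt.le
      nlinarith
    have h2 : 0 ≤ C * Real.exp (-(c3 * Real.sqrt M)) := by positivity
    rw [add_mul]; linarith
  have hM1 : 1 ≤ M := hM01.trans hge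
  rcases lt_or_ge (N : ℝ) (M ^ 2) with hlt | hge2
  · have : {ω | ∃ μ ∈ Set.Icc a b, ∃ v : Fin N → ℂ,
            (∑ i, ‖v i‖ ^ 2) = 1 ∧
            (H ω).mulVec v = (μ : ℂ) • v ∧
            M * (N : ℝ) ^ (1 / p - 1 / 2) ≤ (∑ i, ‖v i‖ ^ p) ^ (1 / p)} = ∅ := by
      ext ω
      simp only [Set.mem_ofPred_eq, Set.mem_empty_iff_false, iff_false]
      rintro ⟨μ, _, v, hv1, _, hv3⟩
      have h1 : ∑ i, ‖v i‖ ^ p ≤ 1 := by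
        rw [← hv1]
        refine Finset.sum_le_sum fun i _ => ?_
        have h2 : ‖v i‖ ^ 2 ≤ 1 := by
          rw [← hv1]
          exact Finset.single_le_sum (f := fun i => ‖v i‖ ^ 2) (fun i _ => by positivity) (Finset.mem_univ i)
        have h3 : ‖v i‖ ≤ 1 := by nlinarith [norm_nonneg (v i)]
        rw [← Real.rpow_natCast]
        exact Real.rpow_le_rpow_of_exponent_ge_of_imp (norm_nonneg _) h3 (by simpa using hp) (fun _ h0 => by linarith)
      have h2 : (∑ i, ‖v i‖ ^ p) ^ (1 / p) ≤ 1 :=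
        Real.rpow_le_one (Finset.sum_nonneg fun i _ => by positivity) h1 (by positivity)
      have h3 : (N : ℝ) ^ (-(1 / 2) : ℝ) ≤ (N : ℝ) ^ (1 / p - 1 / 2) := by
        apply Real.rpow_le_rpow_of_exponent_le (by linarith)
        have : 0 < 1 / p := by positivity
        linarith
      have h4 : M * (N : ℝ) ^ (-(1 / 2) : ℝ) ≤ 1 := (mul_le_mul_of_nonneg_left h3 hM).trans (hv3.trans h2)
      rw [Real.rpow_neg (by linarith), ← Real.sqrt_eq_rpow, ← div_eq_mul_inv, div_le_one (Real.sqrt_pos.2 (by linarith))] at h4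
      have h5 := Real.sqrt_lt_sqrt (by linarith) hlt
      rw [Real.sqrt_sq hM] at h5
      linarith
    rw [this, measure_empty]
    exact zero_le
  set Q := c * M ^ 2 / 64 with hQ
  have hQp : 0 < Q := by positivity
  have hx1 : 1 ≤ 2 * c * N / Q := by
    rw [le_div_iff₀ hQp, hQ]
    nlinarith
  obtain ⟨n, hn1, hn2⟩ := exists_nat_pow_near hx1 (by norm_num : (1 : ℝ) < 2)
  have hXe : (N : ℝ) * (2 * c / 2 ^ (n + 1)) = 2 * c * N / 2 ^ (n + 1) := by ring
  have hXup : (N : ℝ) * (2 * c / 2 ^ (n + 1)) ≤ c * M ^ 2 / 64 := by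
    rw [hXe, div_le_iff₀ (by positivity)]
    rw [div_lt_iff₀ hQp] at hn2
    calc 2 * c * (N : ℝ) ≤ 2 ^ (n + 1) * Q := hn2.le
      _ = c * M ^ 2 / 64 * 2 ^ (n + 1) := by rw [hQ]; ring
  have hXlow : Q / 2 ≤ (N : ℝ) * (2 * c / 2 ^ (n + 1)) := by
    rw [hXe, le_div_iff₀ (by positivity), pow_succ]
    rw [le_div_iff₀ hQp] at hn1
    linarith
  have hQM : c * M / 128 ≤ Q / 2 := by rw [hQ]; nlinarith
  have hbig : x0 + K + 1 ≤ Q / 2 := by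
    refine le_trans ?_ hQM
    rw [le_div_iff₀ (by norm_num)]
    have h1 : c * M0 ≤ c * M := by gcongr
    have h2 : c * M0 = 128 * (x0 + K + 1) + c := by rw [hM0]; field_simp
    linarith
  have hE : a ^ 2 / 4 ≤ 1 - κ1 := by
    have e1 : κ ≤ 2 := by linarith
    have e2 : a ^ 2 ≤ (2 - κ) ^ 2 := by
      apply sq_le_sq'
      · linarith
      · linarith
    have e3 : (2 - κ) ^ 2 ≤ 4 - 2 * κ := by
      have := mul_nonneg hκ.le (sub_nonneg.2 e1)
      linarith
    linarith
  have hmain := hcore N Ω _ P H ν ν' (by omega) hW hCC a M (n + 1) hE (by linarith) (by linarith) (by linarith) hXup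
  refine (measure_mono ?_).trans (hmain.trans (ENNReal.ofReal_le_ofReal ?_))
  · rintro ω ⟨μ, ⟨hμ1, hμ2⟩, v, hv⟩
    refine ⟨μ, ?_, v, hv⟩
    rw [abs_of_nonneg (by linarith)]
    have h1 : μ - a ≤ K / N := by linarith
    refine h1.trans ?_
    rw [div_le_iff₀ (by linarith)]
    linarith
  · have h1 : Real.sqrt (c / 128) * Real.sqrt M ≤ Real.sqrt (N * (2 * c / 2 ^ (n + 1))) := by
      rw [← Real.sqrt_mul (by positivity)]
      apply Real.sqrt_le_sqrt
      linarith
    have h2 : Real.exp (-(c' * Real.sqrt (N * (2 * c / 2 ^ (n + 1))))) ≤ Real.exp (-(c3 * Real.sqrt M)) := by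
      apply Real.exp_le_exp.2
      have := mul_le_mul_of_nonneg_left h1 hc'.le
      rw [hc3]; linarith
    have h3 := Real.exp_pos (c3 * Real.sqrt M0)
    gcongr
    linarith

end Fin3

end Mat

/-- **Delocalization of eigenvectors in `ℓ^p`.** -/
theorem stmt_3 :
    ∀ κ K p δ₀ D D' : ℝ, 0 < κ → 0 < K → 2 ≤ p →
    ∃ C c : ℝ, 0 < C ∧ 0 < c ∧
    ∀ (N : ℕ) (Ω : Type) (_ : MeasurableSpace Ω) (P : Measure Ω)
      (H : Ω → Matrix (Fin N) (Fin N) ℂ) (ν : Measure ℂ) (ν' : Measure ℝ),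
      2 ≤ N →
      IsWignerMatrix P N H ν ν' →
      CondC1 ν ν' δ₀ D D' →
      ∀ a b : ℝ, -2 + κ ≤ a → a ≤ b → b ≤ 2 - κ → b - a = K / N →
      ∀ M : ℝ, 0 ≤ M →
        P {ω | ∃ μ ∈ Set.Icc a b, ∃ v : Fin N → ℂ,
            (∑ i, ‖v i‖ ^ 2) = 1 ∧
            (H ω).mulVec v = (μ : ℂ) • v ∧
            M * (N : ℝ) ^ (1 / p - 1 / 2) ≤ (∑ i, ‖v i‖ ^ p) ^ (1 / p)}
          ≤ ENNReal.ofReal (C * Real.exp (-(c * Real.sqrt M))) :=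
  final_bound

end
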